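/- arXiv:1002.2106 — 2 statements merged into one kernel-verified Lean document; each statement's English description precedes it below -/
import Mathlib

section
/- Every finite-dimensional simple real Lie algebra that is not isomorphic to sl(2,ℝ) contains a Lie subalgebra isomorphic to su(2). -/
/-- `L` contains a Lie subalgebra isomorphic to `su(2)`, i.e. there are three linearly
independent elements satisfying the cross-product bracket relations of `su(2)`. -/
def ContainsSU2 (L : Type*) [LieRing L] [LieAlgebra ℝ L] : Prop :=
  ∃ x y z : L, LinearIndependent ℝ ![x, y, z] ∧ ⁅x, y⁆ = z ∧ ⁅y, z⁆ = x ∧ ⁅z, x⁆ = y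

section partA
open scoped InnerProductSpace

structure IsLieBr {V : Type*} [AddCommGroup V] [Module ℝ V] (ν : V →ₗ[ℝ] V →ₗ[ℝ] V) : Prop where
  alt : ∀ x, ν x x = 0
  jac : ∀ x y z, ν x (ν y z) = ν (ν x y) z + ν y (ν x z)

theorem IsLieBr.skew {V : Type*} [AddCommGroup V] [Module ℝ V] {ν : V →ₗ[ℝ] V →ₗ[ℝ] V}
    (h : IsLieBr ν) (x y : V) : ν x y = - ν y x := by
  have := h.alt (x + y)
  simp only [map_add, LinearMap.add_apply, h.alt, zero_add, add_zero] at this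
  exact eq_neg_of_add_eq_zero_right this

/-- A nonzero symmetric operator preserving a subspace has a nonzero eigenvalue there. -/
theorem exists_eig {V : Type*} [NormedAddCommGroup V] [InnerProductSpace ℝ V]
    [FiniteDimensional ℝ V] (N : Submodule ℝ V) (T : V →ₗ[ℝ] V) (hTN : ∀ x ∈ N, T x ∈ N)
    (hs : ∀ x ∈ N, ∀ y ∈ N, ⟪T x, y⟫_ℝ = ⟪x, T y⟫_ℝ) (m : V) (hm : m ∈ N) (hTm : T m ≠ 0) :
    ∃ c : ℝ, c ≠ 0 ∧ ∃ v ∈ N, v ≠ 0 ∧ T v = c • v := by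
  let R : N →ₗ[ℝ] N := T.restrict hTN
  have hR : R.IsSymmetric := fun x y => hs x x.2 y y.2
  by_contra hcon
  push Not at hcon
  let b := hR.eigenvectorBasis rfl
  have hz : R = 0 := by
    apply b.toBasis.ext
    intro i
    have h1 : R (b i) = hR.eigenvalues rfl i • b i := by
      exact hR.apply_eigenvectorBasis rfl i
    have hb0 : b i ≠ 0 := b.orthonormal.ne_zero i
    by_cases hc : hR.eigenvalues rfl i = 0
    · simp [h1, hc]
    · exfalso
      refine hcon _ hc (b i : V) (b i).2 (by simpa using hb0) ?_
      have := congrArg Subtype.val h1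
      simpa [R] using this
  apply hTm
  have := congrArg Subtype.val (LinearMap.congr_fun hz ⟨m, hm⟩)
  simpa [R] using this

section final
variable {V : Type*} [NormedAddCommGroup V] [InnerProductSpace ℝ V] [FiniteDimensional ℝ V]

theorem torus_lemma {ν : V →ₗ[ℝ] V →ₗ[ℝ] V} (hν : IsLieBr ν) (t : Submodule ℝ V)
    (hab : ∀ x ∈ t, ∀ y ∈ t, ν x y = 0)
    (hsk : ∀ x ∈ t, ∀ u v, ⟪ν x u, v⟫_ℝ = - ⟪u, ν x v⟫_ℝ)
    (M : Submodule ℝ V) (hM : ∀ x ∈ t, ∀ m ∈ M, ν x m ∈ M)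
    (hne : ∃ x ∈ t, ∃ m ∈ M, ν x m ≠ 0) :
    ∃ w ∈ M, ∃ w' ∈ M, ∃ l : V → ℝ, (∀ x ∈ t, ν x w = l x • w' ∧ ν x w' = - l x • w) ∧
      ∃ x ∈ t, l x = 1 ∧ w' ≠ 0 := by
  have hcomm : ∀ x ∈ t, ∀ y ∈ t, ∀ u, ν x (ν y u) = ν y (ν x u) := by
    intro x hx y hy u
    rw [hν.jac, hab x hx y hy]; simp
  have hsq : ∀ x ∈ t, ∀ m, ν x m ≠ 0 → ν x (ν x m) ≠ 0 := by
    intro x hx m hm h0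
    have := hsk x hx m (ν x m)
    rw [h0, inner_zero_right, neg_zero] at this
    exact hm (inner_self_eq_zero.1 this)
  -- a minimal invariant subspace with nontrivial action
  let P : ℕ → Prop := fun d => ∃ N : Submodule ℝ V, N ≤ M ∧ (∀ x ∈ t, ∀ m ∈ N, ν x m ∈ N) ∧
    (∃ x ∈ t, ∃ m ∈ N, ν x m ≠ 0) ∧ Module.finrank ℝ N = d
  have hP : ∃ d, P d := ⟨_, M, le_rfl, hM, hne, rfl⟩
  classical
  obtain ⟨N, hNM, hN, ⟨H, hH, m, hm, hHm⟩, hd⟩ := Nat.find_spec hP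
  have hmin : ∀ N' : Submodule ℝ V, N' ≤ N → (∀ x ∈ t, ∀ m ∈ N', ν x m ∈ N') →
      (∃ x ∈ t, ∃ m ∈ N', ν x m ≠ 0) → N' = N := by
    intro N' h1 h2 h3
    apply Submodule.eq_of_le_of_finrank_le h1
    rw [hd]
    exact Nat.find_min' hP ⟨N', h1.trans hNM, h2, h3, rfl⟩
  have hsym : ∀ x ∈ t, ∀ y ∈ t, ∀ u v, ⟪ν x (ν y u), v⟫_ℝ = ⟪u, ν x (ν y v)⟫_ℝ := by
    intro x hx y hy u v
    rw [hsk x hx, hsk y hy, neg_neg, hcomm y hy x hx]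
  -- eigenspaces
  have heig : ∀ x ∈ t, ∀ c : ℝ, (∃ y ∈ t, ∃ v ∈ N, ν x (ν H v) = c • v ∧ ν y v ≠ 0) →
      ∀ v ∈ N, ν x (ν H v) = c • v := by
    intro x hx c hex
    let N' : Submodule ℝ V := N ⊓ LinearMap.ker ((ν x).comp (ν H) - c • LinearMap.id)
    have hmem : ∀ v, v ∈ N' ↔ v ∈ N ∧ ν x (ν H v) = c • v := by
      intro v; simp [N', sub_eq_zero]
    have : N' = N := by
      apply hmin N' inf_le_left
      · intro y hy v hv
        rw [hmem] at hv ⊢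
        refine ⟨hN y hy v hv.1, ?_⟩
        rw [hcomm H hH y hy, hcomm x hx y hy, hv.2, map_smul]
      · obtain ⟨y, hy, v, hv, h1, h2⟩ := hex
        exact ⟨y, hy, v, (hmem v).2 ⟨hv, h1⟩, h2⟩
    intro v hv
    exact ((hmem v).1 (this ▸ hv)).2
  obtain ⟨c, hc, v, hv, hv0, hcv⟩ := exists_eig N ((ν H).comp (ν H))
    (fun x hx => hN _ hH _ (hN _ hH _ hx)) (fun x _ y _ => hsym H hH H hH x y) m hm
    (hsq H hH m hHm)
  have hHc : ∀ v ∈ N, ν H (ν H v) = c • v := by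
    apply heig H hH c
    refine ⟨H, hH, v, hv, hcv, ?_⟩
    intro h0
    have : c • v = 0 := by rw [← hcv]; simp [h0]
    exact (smul_ne_zero hc hv0) this
  have hinj : ∀ v ∈ N, v ≠ 0 → ν H v ≠ 0 := by
    intro v hv hv0 h0
    have := hHc v hv
    rw [h0, map_zero] at this
    exact smul_ne_zero hc hv0 this.symm
  have hcneg : c < 0 := by
    have h1 := hsk H hH (ν H m) m
    rw [hHc m hm, real_inner_smul_left] at h1
    have hm0 : m ≠ 0 := by rintro rfl; simp at hHm
    have h2 : 0 < ⟪m, m⟫_ℝ := real_inner_self_pos.2 hm0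
    have h3 : 0 < ⟪ν H m, ν H m⟫_ℝ := real_inner_self_pos.2 hHm
    nlinarith
  have hall : ∀ x : V, ∃ d : ℝ, x ∈ t → ∀ v ∈ N, ν x (ν H v) = d • v := by
    intro x
    by_cases hx : x ∈ t
    swap
    · exact ⟨0, fun h => absurd h hx⟩
    by_cases h0 : ∀ v ∈ N, ν x (ν H v) = 0
    · exact ⟨0, fun _ v hv => by simp [h0 v hv]⟩
    push Not at h0
    obtain ⟨m, hm, hm0⟩ := h0
    obtain ⟨d, hd, v, hv, hv0, hdv⟩ := exists_eig N ((ν x).comp (ν H))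
      (fun y hy => hN _ hx _ (hN _ hH _ hy)) (fun y _ z _ => hsym x hx H hH y z) m hm hm0
    exact ⟨d, fun _ => heig x hx d ⟨H, hH, v, hv, hdv, hinj v hv hv0⟩⟩
  choose d hd using hall
  set s := Real.sqrt (-c) with hs
  have hs0 : 0 < s := Real.sqrt_pos.2 (by linarith)
  have hss : s * s = -c := Real.mul_self_sqrt (by linarith)
  refine ⟨m, hNM hm, s⁻¹ • ν H m, M.smul_mem _ (hNM (hN H hH m hm)), fun x => - d x / s, ?_,
    s⁻¹ • H, t.smul_mem _ hH, ?_, smul_ne_zero (inv_ne_zero hs0.ne') hHm⟩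
  · intro x hx
    have h1 := hd x hx m hm
    have h2 : ν x m = (d x / c) • ν H m := by
      have h3 := hd x hx (ν H m) (hN H hH m hm)
      rw [hHc m hm, map_smul] at h3
      rw [div_eq_inv_mul, mul_smul, ← h3, smul_smul, inv_mul_cancel₀ hc, one_smul]
    constructor
    · rw [h2, smul_smul]
      congr 1
      have : c = - (s * s) := by linarith
      rw [this]; field_simp
    · rw [map_smul, h1, smul_smul]
      congr 1; field_simp
  · have h1 := hd (s⁻¹ • H) (t.smul_mem _ hH) m hm
    rw [map_smul, LinearMap.smul_apply, hHc m hm, smul_smul] at h1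
    have hm0 : m ≠ 0 := by rintro rfl; simp at hHm
    have h2 : s⁻¹ * c = d (s⁻¹ • H) := smul_left_injective ℝ hm0 h1
    change - d (s⁻¹ • H) / s = 1
    rw [← h2]
    have : c = - (s * s) := by linarith
    rw [this]; field_simp

/-- Compact case. -/
theorem compact_case {ν : V →ₗ[ℝ] V →ₗ[ℝ] V} (hν : IsLieBr ν) (k : Submodule ℝ V)
    (hk : ∀ x ∈ k, ∀ y ∈ k, ν x y ∈ k)
    (hsk : ∀ x ∈ k, ∀ u v, ⟪ν x u, v⟫_ℝ = - ⟪u, ν x v⟫_ℝ)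
    (hne : ∃ x ∈ k, ∃ y ∈ k, ν x y ≠ 0) :
    ∃ x y z : V, x ≠ 0 ∧ ν x y = z ∧ ν y z = x ∧ ν z x = y := by
  classical
  let P : ℕ → Prop := fun d => ∃ t : Submodule ℝ V, t ≤ k ∧ (∀ x ∈ t, ∀ y ∈ t, ν x y = 0) ∧
    Module.finrank ℝ t = d
  have hP : ∃ d, P d := ⟨_, ⊥, bot_le, by simp, rfl⟩
  obtain ⟨t, htk, hab, hd⟩ : P (Nat.findGreatest P (Module.finrank ℝ V)) := by
    refine Nat.findGreatest_spec (m := 0) (Nat.zero_le _) ⟨⊥, bot_le, by simp, by simp⟩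
  have hmax : ∀ x ∈ k, (∀ y ∈ t, ν y x = 0) → x ∈ t := by
    intro x hx hxt
    have hle : t ≤ t ⊔ Submodule.span ℝ {x} := le_sup_left
    have : t = t ⊔ Submodule.span ℝ {x} := by
      apply Submodule.eq_of_le_of_finrank_le hle
      rw [hd]
      refine Nat.le_findGreatest (Submodule.finrank_le _) ⟨_, ?_, ?_, rfl⟩
      · refine sup_le htk ?_
        rw [Submodule.span_singleton_le_iff_mem]; exact hx
      · intro a ha b hb
        obtain ⟨a, ha1, a', ha', rfl⟩ := Submodule.mem_sup.1 ha
        obtain ⟨b, hb1, b', hb', rfl⟩ := Submodule.mem_sup.1 hb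
        obtain ⟨p, rfl⟩ := Submodule.mem_span_singleton.1 ha'
        obtain ⟨q, rfl⟩ := Submodule.mem_span_singleton.1 hb'
        simp [hab a ha1 b hb1, hxt a ha1, hν.alt, hν.skew x b, hxt b hb1]
    rw [this]
    exact Submodule.mem_sup_right (Submodule.mem_span_singleton_self x)
  have hne' : ∃ x ∈ t, ∃ m ∈ k, ν x m ≠ 0 := by
    by_contra hcon
    push Not at hcon
    have hkt : ∀ x ∈ k, x ∈ t := fun x hx => hmax x hx (fun y hy => hcon y hy x hx)
    obtain ⟨x, hx, y, hy, h⟩ := hne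
    exact h (hab x (hkt x hx) y (hkt y hy))
  obtain ⟨w, hw, w', hw', l, hl, H, hH, hlH, hw0⟩ := torus_lemma hν t hab
    (fun x hx => hsk x (htk hx)) k (fun x hx => hk x (htk hx)) hne'
  have hK : ν w w' ∈ t := by
    apply hmax _ (hk w hw w' hw')
    intro y hy
    rw [hν.jac, (hl y hy).1, (hl y hy).2]
    simp [hν.alt]
  set K := ν w w' with hKdef
  have hin : ∀ x ∈ t, ⟪K, x⟫_ℝ = l x * ⟪w', w'⟫_ℝ := by
    intro x hx
    rw [hKdef, hsk w hw, hν.skew w x, (hl x hx).1, inner_neg_right, neg_neg, real_inner_smul_right]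
  have hw'p : 0 < ⟪w', w'⟫_ℝ := real_inner_self_pos.2 hw0
  have hK0 : K ≠ 0 := by
    intro h0
    have := hin H hH
    rw [h0, hlH, inner_zero_left] at this
    linarith
  have hlK : 0 < l K := by
    have h1 := hin K hK
    have h2 : 0 < ⟪K, K⟫_ℝ := real_inner_self_pos.2 hK0
    rw [h1] at h2
    exact pos_of_mul_pos_left h2 hw'p.le
  obtain ⟨h1, h2⟩ := hl K hK
  set s := Real.sqrt (l K) with hs
  have hs0 : 0 < s := Real.sqrt_pos.2 hlK
  have hss : s * s = l K := Real.mul_self_sqrt hlK.le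
  have hwne : w ≠ 0 := by
    rintro rfl
    exact hK0 (by simp [hKdef])
  refine ⟨s⁻¹ • w, s⁻¹ • w', (s * s)⁻¹ • K, smul_ne_zero (inv_ne_zero hs0.ne') hwne, ?_, ?_, ?_⟩
  · simp only [map_smul, LinearMap.smul_apply, smul_smul, ← hKdef]
    congr 1; field_simp
  · simp only [map_smul, LinearMap.smul_apply, hν.skew w' K, h2, ← hss]
    simp only [neg_smul, neg_neg, smul_smul]
    congr 1; field_simp
  · simp only [map_smul, LinearMap.smul_apply, h1, ← hss, smul_smul]
    congr 1; field_simp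

theorem abelian_case {ν : V →ₗ[ℝ] V →ₗ[ℝ] V} (hν : IsLieBr ν) (k p : Submodule ℝ V)
    (hkp : k ⊔ p = ⊤) (hkab : ∀ x ∈ k, ∀ y ∈ k, ν x y = 0)
    (hkpp : ∀ x ∈ k, ∀ y ∈ p, ν x y ∈ p) (hppk : ∀ x ∈ p, ∀ y ∈ p, ν x y ∈ k)
    (hsk : ∀ x ∈ k, ∀ u v, ⟪ν x u, v⟫_ℝ = - ⟪u, ν x v⟫_ℝ)
    (hsy : ∀ x ∈ p, ∀ u v, ⟪ν x u, v⟫_ℝ = ⟪u, ν x v⟫_ℝ)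
    (hsimple : ∀ I : Submodule ℝ V, (∀ x, ∀ y ∈ I, ν x y ∈ I) → I = ⊥ ∨ I = ⊤)
    (hcen : ∀ x, (∀ y, ν x y = 0) → x = 0)
    (hne : ∃ x y, ν x y ≠ 0) :
    ∃ x y z : V, x ≠ 0 ∧ ν x y = z ∧ ν z y = x ∧ ν z x = - y ∧
      ∀ v, ∃ a b c : ℝ, v = a • x + b • y + c • z := by
  have hdec : ∀ v, ∃ a ∈ k, ∃ b ∈ p, a + b = v := fun v =>
    Submodule.mem_sup.1 (hkp ▸ Submodule.mem_top)
  have hne' : ∃ x ∈ k, ∃ m ∈ p, ν x m ≠ 0 := by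
    by_contra hcon
    push Not at hcon
    have hk0 : ∀ x ∈ k, x = 0 := by
      intro x hx
      apply hcen
      intro y
      obtain ⟨a, ha, b, hb, rfl⟩ := hdec y
      rw [map_add, hkab x hx a ha, hcon x hx b hb, add_zero]
    obtain ⟨x, y, h⟩ := hne
    obtain ⟨a, ha, b, hb, rfl⟩ := hdec x
    obtain ⟨a', ha', b', hb', rfl⟩ := hdec y
    rw [hk0 a ha, hk0 a' ha', zero_add, zero_add] at h
    exact h (hk0 _ (hppk b hb b' hb'))
  obtain ⟨w, hw, w', hw', l, hl, H, hH, hlH, hw0⟩ := torus_lemma hν k hkab hsk p hkpp hne'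
  have hK : ν w w' ∈ k := hppk w hw w' hw'
  set K := ν w w' with hKdef
  have hin : ∀ x ∈ k, ⟪K, x⟫_ℝ = - l x * ⟪w', w'⟫_ℝ := by
    intro x hx
    rw [hKdef, hsy w hw, hν.skew w x, (hl x hx).1, inner_neg_right, real_inner_smul_right]
    ring
  have hw'p : 0 < ⟪w', w'⟫_ℝ := real_inner_self_pos.2 hw0
  have hK0 : K ≠ 0 := by
    intro h0
    have := hin H hH
    rw [h0, hlH, inner_zero_left] at this
    linarith
  have hlK : 0 < - l K := by
    have h1 := hin K hK
    have h2 : 0 < ⟪K, K⟫_ℝ := real_inner_self_pos.2 hK0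
    rw [h1] at h2
    exact pos_of_mul_pos_left h2 hw'p.le
  obtain ⟨h1, h2⟩ := hl K hK
  have hwne : w ≠ 0 := by
    rintro rfl
    exact hK0 (by simp [hKdef])
  let U : Submodule ℝ V := Submodule.span ℝ {w, w'}
  have hUp : U ≤ p := by
    rw [Submodule.span_le]
    rintro x (rfl | rfl)
    · exact hw
    · exact hw'
  have hwU : w ∈ U := Submodule.subset_span (by simp)
  have hw'U : w' ∈ U := Submodule.subset_span (by simp)
  have hperp : ∀ v ∈ p, ⟪w, v⟫_ℝ = 0 → ⟪w', v⟫_ℝ = 0 → ν v w = 0 ∧ ν v w' = 0 := by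
    intro v hv e1 e2
    constructor
    · have hm := hppk v hv w hw
      have : ⟪ν v w, ν v w⟫_ℝ = 0 := by
        rw [hsy v hv]
        generalize ν v w = x at hm ⊢
        rw [hν.skew v x, inner_neg_right, ← hsk x hm, (hl x hm).1,
          real_inner_smul_left, e2, mul_zero]
      exact inner_self_eq_zero.1 this
    · have hm := hppk v hv w' hw'
      have : ⟪ν v w', ν v w'⟫_ℝ = 0 := by
        rw [hsy v hv]
        generalize ν v w' = x at hm ⊢
        rw [hν.skew v x, inner_neg_right, ← hsk x hm, (hl x hm).2,
          real_inner_smul_left, e1, mul_zero]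
      exact inner_self_eq_zero.1 this
  let I : Submodule ℝ V := Submodule.span ℝ {w, w', K}
  have hwI : w ∈ I := Submodule.subset_span (by simp)
  have hw'I : w' ∈ I := Submodule.subset_span (by simp)
  have hKI : K ∈ I := Submodule.subset_span (by simp)
  have hgen : ∀ x, ν x w ∈ I → ν x w' ∈ I → ν x K ∈ I → ∀ y ∈ I, ν x y ∈ I := by
    intro x e1 e2 e3 y hy
    have : I ≤ I.comap (ν x) := by
      rw [Submodule.span_le]
      rintro y (rfl | rfl | rfl)
      · exact e1
      · exact e2
      · exact e3
    exact this hy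
  have hIk : ∀ x ∈ k, ∀ y ∈ I, ν x y ∈ I := by
    intro x hx
    apply hgen
    · rw [(hl x hx).1]; exact I.smul_mem _ hw'I
    · rw [(hl x hx).2]; exact I.smul_mem _ hwI
    · rw [hkab x hx K hK]; exact I.zero_mem
  have hIw : ∀ y ∈ I, ν w y ∈ I := by
    apply hgen
    · rw [hν.alt]; exact I.zero_mem
    · exact hKI
    · rw [hν.skew, h1]; exact I.neg_mem (I.smul_mem _ hw'I)
  have hIw' : ∀ y ∈ I, ν w' y ∈ I := by
    apply hgen
    · rw [hν.skew]; exact I.neg_mem hKI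
    · rw [hν.alt]; exact I.zero_mem
    · rw [hν.skew, h2]; exact I.neg_mem (I.smul_mem _ hwI)
  have hIp : ∀ x ∈ p, ∀ y ∈ I, ν x y ∈ I := by
    intro x hx y hy
    have hxU : U.starProjection x ∈ U := Submodule.starProjection_apply_mem U x
    have hv := Submodule.sub_starProjection_mem_orthogonal (K := U) x
    set u := U.starProjection x
    have hxe : x = u + (x - u) := by abel
    have hvp : x - u ∈ p := p.sub_mem hx (hUp hxU)
    obtain ⟨q1, q2⟩ := hperp (x - u) hvp (hv w hwU) (hv w' hw'U)
    rw [hxe, map_add, LinearMap.add_apply]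
    apply I.add_mem
    · obtain ⟨a, b, hab⟩ := Submodule.mem_span_pair.1 hxU
      rw [← hab]
      simp only [map_add, map_smul, LinearMap.add_apply, LinearMap.smul_apply]
      exact I.add_mem (I.smul_mem _ (hIw y hy)) (I.smul_mem _ (hIw' y hy))
    · revert y
      apply hgen
      · rw [q1]; exact I.zero_mem
      · rw [q2]; exact I.zero_mem
      · rw [hKdef, hν.jac, q1, q2]; simp
  have hItop : I = ⊤ := by
    refine (hsimple I ?_).resolve_left ?_
    · intro x y hy
      obtain ⟨a, ha, b, hb, rfl⟩ := hdec x
      rw [map_add, LinearMap.add_apply]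
      exact I.add_mem (hIk a ha y hy) (hIp b hb y hy)
    · intro h0
      rw [h0] at hwI
      exact hwne (by simpa using hwI)
  set s := Real.sqrt (- l K) with hs
  have hs0 : 0 < s := Real.sqrt_pos.2 hlK
  have hss : s * s = - l K := Real.mul_self_sqrt hlK.le
  have hlK' : l K = - (s * s) := by linarith
  refine ⟨s⁻¹ • w, s⁻¹ • w', (s * s)⁻¹ • K, smul_ne_zero (inv_ne_zero hs0.ne') hwne,
    ?_, ?_, ?_, ?_⟩
  · simp only [map_smul, LinearMap.smul_apply, smul_smul, ← hKdef]
    congr 1; field_simp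
  · simp only [map_smul, LinearMap.smul_apply, h2, hlK', smul_smul]
    congr 1; field_simp
  · simp only [map_smul, LinearMap.smul_apply, h1, hlK', smul_smul, ← neg_smul]
    congr 1; field_simp
  · intro v
    have hv : v ∈ I := hItop ▸ Submodule.mem_top
    obtain ⟨a, b, c, rfl⟩ := Submodule.mem_span_triple.1 hv
    refine ⟨a * s, b * s, c * (s * s), ?_⟩
    simp only [smul_smul]
    congr 2
    · congr 1; field_simp
    · congr 1; field_simp
    · congr 1; field_simp

/-- Real Lie bracket with self-adjoint inner derivations: dichotomy. -/
theorem dichotomy {ν : V →ₗ[ℝ] V →ₗ[ℝ] V} (hν : IsLieBr ν)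
    (hstar : ∀ x, ∃ y, ∀ u v, ⟪ν x u, v⟫_ℝ = ⟪u, ν y v⟫_ℝ)
    (hsimple : ∀ I : Submodule ℝ V, (∀ x, ∀ y ∈ I, ν x y ∈ I) → I = ⊥ ∨ I = ⊤)
    (hne : ∃ x y, ν x y ≠ 0) :
    (∃ x y z : V, x ≠ 0 ∧ ν x y = z ∧ ν y z = x ∧ ν z x = y) ∨
    (∃ x y z : V, x ≠ 0 ∧ ν x y = z ∧ ν z y = x ∧ ν z x = - y ∧
      ∀ v, ∃ a b c : ℝ, v = a • x + b • y + c • z) := by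
  have hcen : ∀ x, (∀ y, ν x y = 0) → x = 0 := by
    intro x hx
    have hid : ∀ a, ∀ b ∈ LinearMap.ker ν, ν a b ∈ LinearMap.ker ν := by
      intro a b hb
      rw [LinearMap.mem_ker] at hb
      rw [hν.skew, hb]; simp
    rcases hsimple (LinearMap.ker ν) hid with h | h
    · have : x ∈ LinearMap.ker ν := by
        rw [LinearMap.mem_ker]; ext1 y; simp [hx y]
      rw [h] at this
      simpa using this
    · exfalso
      obtain ⟨a, b, hab⟩ := hne
      have : a ∈ LinearMap.ker ν := h ▸ Submodule.mem_top
      rw [LinearMap.mem_ker] at this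
      exact hab (by simp [this])
  let k : Submodule ℝ V :=
    { carrier := {x | ∀ u v, ⟪ν x u, v⟫_ℝ = - ⟪u, ν x v⟫_ℝ}
      add_mem' := by
        intro a b ha hb u v
        simp only [map_add, LinearMap.add_apply, inner_add_left, inner_add_right, ha u v, hb u v]
        ring
      zero_mem' := by intro u v; simp
      smul_mem' := by
        intro c a ha u v
        simp only [map_smul, LinearMap.smul_apply, real_inner_smul_left, real_inner_smul_right,
          ha u v]
        ring }
  let p : Submodule ℝ V :=
    { carrier := {x | ∀ u v, ⟪ν x u, v⟫_ℝ = ⟪u, ν x v⟫_ℝ}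
      add_mem' := by
        intro a b ha hb u v
        simp only [map_add, LinearMap.add_apply, inner_add_left, inner_add_right, ha u v, hb u v]
      zero_mem' := by intro u v; simp
      smul_mem' := by
        intro c a ha u v
        simp only [map_smul, LinearMap.smul_apply, real_inner_smul_left, real_inner_smul_right,
          ha u v] }
  have hk : ∀ x ∈ k, ∀ u v, ⟪ν x u, v⟫_ℝ = - ⟪u, ν x v⟫_ℝ := fun x hx => hx
  have hp : ∀ x ∈ p, ∀ u v, ⟪ν x u, v⟫_ℝ = ⟪u, ν x v⟫_ℝ := fun x hx => hx
  have hbr : ∀ x y u, ν (ν x y) u = ν x (ν y u) - ν y (ν x u) := by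
    intro x y u; rw [hν.jac x y u]; abel
  have hkp : k ⊔ p = ⊤ := by
    rw [eq_top_iff]
    intro x _
    obtain ⟨y, hy⟩ := hstar x
    have hy' : ∀ u v, ⟪ν y u, v⟫_ℝ = ⟪u, ν x v⟫_ℝ := by
      intro u v
      rw [real_inner_comm, ← hy, real_inner_comm]
    refine Submodule.mem_sup.2 ⟨(1/2 : ℝ) • (x - y), ?_, (1/2 : ℝ) • (x + y), ?_, ?_⟩
    · apply k.smul_mem
      intro u v
      simp only [map_sub, LinearMap.sub_apply, inner_sub_left, inner_sub_right, hy, hy']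
      ring
    · apply p.smul_mem
      intro u v
      simp only [map_add, LinearMap.add_apply, inner_add_left, inner_add_right, hy, hy']
      ring
    · module
  by_cases hab : ∀ x ∈ k, ∀ y ∈ k, ν x y = 0
  · right
    refine abelian_case hν k p hkp hab ?_ ?_ hk hp hsimple hcen hne
    · intro x hx y hy u v
      simp only [hbr, inner_sub_left, inner_sub_right, hk x hx, hp y hy]
      ring
    · intro x hx y hy u v
      simp only [hbr, inner_sub_left, inner_sub_right, hp x hx, hp y hy]
      ring
  · left
    push Not at hab
    refine compact_case hν k ?_ hk hab
    intro x hx y hy u v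
    simp only [hbr, inner_sub_left, inner_sub_right, hk x hx, hk y hy]
    ring
end final
end partA

section coh
variable {V : Type*} [AddCommGroup V] [Module ℝ V]

/-- The Killing form of a bracket. -/
noncomputable def kf (ν : V →ₗ[ℝ] V →ₗ[ℝ] V) : LinearMap.BilinForm ℝ V :=
  LinearMap.mk₂ ℝ (fun x y => LinearMap.trace ℝ V (ν x * ν y))
    (by intro a b c; simp [add_mul]) (by intro a b c; simp)
    (by intro a b c; simp [mul_add]) (by intro a b c; simp)

theorem kf_apply (ν : V →ₗ[ℝ] V →ₗ[ℝ] V) (x y : V) :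
    kf ν x y = LinearMap.trace ℝ V (ν x * ν y) := rfl

theorem kf_symm (ν : V →ₗ[ℝ] V →ₗ[ℝ] V) (x y : V) : kf ν x y = kf ν y x := by
  rw [kf_apply, kf_apply, LinearMap.trace_mul_comm]

theorem kf_inv {ν : V →ₗ[ℝ] V →ₗ[ℝ] V} (hν : IsLieBr ν) (x y z : V) :
    kf ν (ν x y) z = - kf ν y (ν x z) := by
  have hbr : ∀ a b, ν (ν a b) = ν a * ν b - ν b * ν a := by
    intro a b; ext u
    simp only [LinearMap.sub_apply, Module.End.mul_apply]
    rw [hν.jac a b u]; abel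
  rw [kf_apply, kf_apply, hbr, hbr, sub_mul, mul_sub, map_sub, map_sub]
  rw [← mul_assoc (ν y) (ν z), LinearMap.trace_mul_comm ℝ (ν y * ν z) (ν x), mul_assoc, mul_assoc]
  ring

/-- Second Whitehead lemma for the adjoint representation. -/
theorem whitehead2 [FiniteDimensional ℝ V] {ν : V →ₗ[ℝ] V →ₗ[ℝ] V} (hν : IsLieBr ν) (hB : (kf ν).Nondegenerate)
    (w : V →ₗ[ℝ] V →ₗ[ℝ] V) (halt : ∀ x y, w x y = - w y x)
    (hco : ∀ x y z, ν x (w y z) + ν y (w z x) + ν z (w x y)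
      - w (ν x y) z - w (ν y z) x - w (ν z x) y = 0) :
    ∃ a : V →ₗ[ℝ] V, ∀ x y, w x y = ν x (a y) - ν y (a x) - a (ν x y) := by
  let b := Module.finBasis ℝ V
  let f := (kf ν).dualBasis hB b
  have hb : ∀ v, v = ∑ i, kf ν (f i) v • b i := by
    intro v
    have h1 : ∀ i, b.repr v i = kf ν (f i) v := by
      intro i
      conv_rhs => rw [← b.sum_repr v]
      simp only [map_sum, map_smul, f, LinearMap.BilinForm.apply_dualBasis_left, smul_eq_mul,
        mul_ite, mul_one, mul_zero, Finset.sum_ite_eq', Finset.mem_univ, if_true]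
    simp_rw [← h1]
    exact (b.sum_repr v).symm
  have hf : ∀ v, v = ∑ i, kf ν v (b i) • f i := by
    intro v
    conv_lhs => rw [← f.sum_repr v]
    simp [f]
  have hinv : ∀ (Ψ : V →ₗ[ℝ] V →ₗ[ℝ] V) (x : V),
      ∑ i, (Ψ (ν x (b i)) (f i) + Ψ (b i) (ν x (f i))) = 0 := by
    intro Ψ x
    rw [Finset.sum_add_distrib]
    have e1 : ∑ i, Ψ (ν x (b i)) (f i) = ∑ i, ∑ j, kf ν (f j) (ν x (b i)) • Ψ (b j) (f i) := by
      refine Finset.sum_congr rfl fun i _ => ?_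
      conv_lhs => rw [hb (ν x (b i))]
      simp
    have e2 : ∑ i, Ψ (b i) (ν x (f i)) = ∑ i, ∑ j, kf ν (ν x (f i)) (b j) • Ψ (b i) (f j) := by
      refine Finset.sum_congr rfl fun i _ => ?_
      conv_lhs => rw [hf (ν x (f i))]
      simp
    rw [e1, e2, Finset.sum_comm, ← Finset.sum_add_distrib]
    refine Finset.sum_eq_zero fun i _ => ?_
    rw [← Finset.sum_add_distrib]
    refine Finset.sum_eq_zero fun j _ => ?_
    rw [kf_inv hν]; simp
  have hcas : ∀ z, ∑ i, ν (b i) (ν (f i) z) = z := by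
    intro z
    have key : ∀ u, kf ν (∑ i, ν (b i) (ν (f i) z)) u = kf ν z u := by
      intro u
      rw [map_sum, LinearMap.sum_apply, kf_apply ν z u, LinearMap.trace_eq_matrix_trace ℝ b,
        Matrix.trace]
      refine Finset.sum_congr rfl fun i _ => ?_
      have h1 : ∀ v, b.repr v i = kf ν (f i) v := by
        intro v
        conv_rhs => rw [← b.sum_repr v]
        simp only [map_sum, map_smul, f, LinearMap.BilinForm.apply_dualBasis_left, smul_eq_mul,
        mul_ite, mul_one, mul_zero, Finset.sum_ite_eq', Finset.mem_univ, if_true]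
      rw [Matrix.diag_apply, LinearMap.toMatrix_apply, h1, kf_inv hν, hν.skew (f i) z,
        Module.End.mul_apply, hν.skew (b i) u]
      simp only [map_neg, LinearMap.neg_apply, neg_neg]
      rw [kf_inv hν, neg_neg]
    have h0 : kf ν (∑ i, ν (b i) (ν (f i) z) - z) = 0 := by
      ext1 u; rw [map_sub, LinearMap.sub_apply, key]; simp
    exact sub_eq_zero.1 (LinearMap.ker_eq_bot'.1 hB.ker_eq_bot _ h0)
  let a : V →ₗ[ℝ] V := ∑ i, (ν (b i)).comp (w (f i))
  have ha : ∀ x, a x = ∑ i, ν (b i) (w (f i) x) := by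
    intro x; simp [a, LinearMap.sum_apply]
  refine ⟨a, fun x y => ?_⟩
  have hX : ∀ x y, ∑ i, (ν (ν x (b i)) (w (f i) y) + ν (b i) (w (ν x (f i)) y)) = 0 := by
    intro x y
    exact hinv (LinearMap.mk₂ ℝ (fun p q => ν p (w q y)) (by simp) (by simp) (by simp) (by simp)) x
  have h1 := hX x y
  have h2 := hX y x
  have h3 := hcas (w x y)
  rw [ha, ha, ha, map_sum, map_sum, ← Finset.sum_sub_distrib, ← Finset.sum_sub_distrib]
  have : w x y = ∑ i, ν (b i) (ν (f i) (w x y))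
      + ∑ i, (ν (ν x (b i)) (w (f i) y) + ν (b i) (w (ν x (f i)) y))
      - ∑ i, (ν (ν y (b i)) (w (f i) x) + ν (b i) (w (ν y (f i)) x)) := by
    rw [h1, h2, h3]; simp
  rw [this, ← Finset.sum_add_distrib, ← Finset.sum_sub_distrib]
  refine Finset.sum_congr rfl fun i _ => ?_
  have hc := congrArg (ν (b i)) (hco x y (f i))
  rw [hν.jac x (b i), hν.jac y (b i)]
  rw [halt (ν x y) (f i), halt y (f i), hν.skew (f i) x] at hc
  simp only [map_add, map_sub, map_neg, map_zero, LinearMap.neg_apply] at hc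
  rw [← sub_eq_zero]
  rw [← hc]
  abel
end coh

section rigid
open Filter Topology
variable {V : Type*} [NormedAddCommGroup V] [InnerProductSpace ℝ V]

/-- Forget continuity of a bilinear map. -/
noncomputable def tl (ν : V →L[ℝ] V →L[ℝ] V) : V →ₗ[ℝ] V →ₗ[ℝ] V :=
  LinearMap.mk₂ ℝ (fun x y => ν x y) (by simp) (by simp) (by simp) (by simp)

@[simp] theorem tl_apply (ν : V →L[ℝ] V →L[ℝ] V) (x y : V) : tl ν x y = ν x y := rfl

/-- Regard a bilinear map on a finite dimensional space as a continuous one. -/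
noncomputable def ct [FiniteDimensional ℝ V] (ν : V →ₗ[ℝ] V →ₗ[ℝ] V) : V →L[ℝ] V →L[ℝ] V :=
  LinearMap.toContinuousLinearMap
    ((LinearMap.toContinuousLinearMap : (V →ₗ[ℝ] V) ≃ₗ[ℝ] (V →L[ℝ] V)).toLinearMap ∘ₗ ν)

@[simp] theorem ct_apply [FiniteDimensional ℝ V] (ν : V →ₗ[ℝ] V →ₗ[ℝ] V) (x y : V) :
    ct ν x y = ν x y := rfl

theorem IsLieBr.transfer {A B : Type*} [AddCommGroup A] [Module ℝ A] [AddCommGroup B] [Module ℝ B]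
    {μ : A →ₗ[ℝ] A →ₗ[ℝ] A} {ν : B →ₗ[ℝ] B →ₗ[ℝ] B} (g : A ≃ₗ[ℝ] B)
    (hg : ∀ x y, g (μ x y) = ν (g x) (g y)) (h : IsLieBr μ) : IsLieBr ν := by
  constructor
  · intro x
    obtain ⟨x, rfl⟩ := g.surjective x
    rw [← hg, h.alt, map_zero]
  · intro x y z
    obtain ⟨x, rfl⟩ := g.surjective x
    obtain ⟨y, rfl⟩ := g.surjective y
    obtain ⟨z, rfl⟩ := g.surjective z
    simp only [← hg]
    rw [h.jac, map_add]

theorem bil_ext {ι : Type*} [Fintype ι] (e : OrthonormalBasis ι ℝ V) {a b : V →ₗ[ℝ] V →ₗ[ℝ] V}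
    (h : ∀ i j, a (e i) (e j) = b (e i) (e j)) : a = b := by
  apply e.toBasis.ext
  intro i
  apply e.toBasis.ext
  intro j
  simpa using h i j

theorem exists_slice {E : Type*} [AddCommGroup E] [Module ℝ E] [TopologicalSpace E]
    [IsTopologicalAddGroup E] [ContinuousSMul ℝ E] [FiniteDimensional ℝ E]
    (R : Submodule ℝ E) : ∃ (d : ℕ) (J : EuclideanSpace ℝ (Fin d) →L[ℝ] E),
      (∀ c, ∃ r ∈ R, ∃ f, r + J f = c) ∧ ∀ f, J f ∈ R → f = 0 := by
  obtain ⟨W, hW⟩ := Submodule.exists_isCompl R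
  let φ : EuclideanSpace ℝ (Fin (Module.finrank ℝ W)) ≃ₗ[ℝ] W :=
    LinearEquiv.ofFinrankEq _ _ (by simp)
  refine ⟨_, LinearMap.toContinuousLinearMap (W.subtype ∘ₗ φ.toLinearMap), ?_, ?_⟩
  · intro c
    have hc : c ∈ R ⊔ W := hW.sup_eq_top ▸ Submodule.mem_top
    obtain ⟨r, hr, w, hw, h⟩ := Submodule.mem_sup.1 hc
    refine ⟨r, hr, φ.symm ⟨w, hw⟩, ?_⟩
    simpa using h
  · intro f hf
    have : ((φ f : W) : E) ∈ R ⊓ W := ⟨hf, (φ f).2⟩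
    rw [hW.inf_eq_bot] at this
    simpa using this

set_option maxSynthPendingDepth 6 in
set_option maxHeartbeats 1600000 in
theorem rigid [FiniteDimensional ℝ V] {ι : Type*} [Fintype ι] (e : OrthonormalBasis ι ℝ V)
    (ν : V →L[ℝ] V →L[ℝ] V)
    (hν : IsLieBr (tl ν)) (hB : (kf (tl ν)).Nondegenerate) :
    ∀ᶠ μ in 𝓝 ν, IsLieBr (tl μ) → ∃ g : V ≃ₗ[ℝ] V, ∀ x y, g (μ x y) = ν (g x) (g y) := by
  classical
  let R : Submodule ℝ (V →L[ℝ] V →L[ℝ] V) :=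
    { carrier := {c | ∃ a : V →L[ℝ] V, ∀ x y, c x y = ν x (a y) + ν (a x) y - a (ν x y)}
      add_mem' := by
        rintro c d ⟨a, ha⟩ ⟨b, hb⟩
        refine ⟨a + b, fun x y => ?_⟩
        simp only [_root_.add_apply, map_add, ha, hb]; abel
      zero_mem' := ⟨0, by simp⟩
      smul_mem' := by
        rintro r c ⟨a, ha⟩
        refine ⟨r • a, fun x y => ?_⟩
        simp only [_root_.smul_apply, map_smul, ha, smul_add, smul_sub] }
  obtain ⟨dW, J, hJ1, hJ2⟩ := exists_slice R
  have : FiniteDimensional ℝ (V →L[ℝ] V →L[ℝ] V) := inferInstance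
  have : CompleteSpace (V →L[ℝ] V) := FiniteDimensional.complete ℝ _
  have : CompleteSpace (V →L[ℝ] V →L[ℝ] V) := FiniteDimensional.complete ℝ _
  have : CompleteSpace V := FiniteDimensional.complete ℝ _
  -- linearised structure map, injective on the slice
  let D : (EuclideanSpace ℝ (Fin dW)) →ₗ[ℝ] (ι → ι → V) × (ι → ι → ι → V) :=
    { toFun := fun w => (fun i j => J w (e i) (e j) + J w (e j) (e i), fun i j k =>
        ν (e i) (J w (e j) (e k)) + ν (e j) (J w (e k) (e i)) + ν (e k) (J w (e i) (e j))
        + J w (e i) (ν (e j) (e k)) + J w (e j) (ν (e k) (e i)) + J w (e k) (ν (e i) (e j)))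
      map_add' := by
        intro a b
        ext1
        · funext i j; simp; abel
        · funext i j k; simp; abel
      map_smul' := by
        intro a b
        ext1
        · funext i j; simp
        · funext i j k; simp }
  have hD : LinearMap.ker D = ⊥ := by
    rw [LinearMap.ker_eq_bot']
    intro w hw
    have hw1 : ∀ i j, J w (e i) (e j) + J w (e j) (e i) = 0 := fun i j =>
      congrFun (congrFun (congrArg Prod.fst hw) i) j
    have hw2 : ∀ i j k, ν (e i) (J w (e j) (e k)) + ν (e j) (J w (e k) (e i))
        + ν (e k) (J w (e i) (e j))
        + J w (e i) (ν (e j) (e k)) + J w (e j) (ν (e k) (e i)) + J w (e k) (ν (e i) (e j)) = 0 :=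
      fun i j k => congrFun (congrFun (congrFun (congrArg Prod.snd hw) i) j) k
    have halt : ∀ x y, J w x y = - J w y x := by
      have : tl (J w) = - (tl (J w)).flip := bil_ext e fun i j => by
        simpa using eq_neg_of_add_eq_zero_left (hw1 i j)
      intro x y
      have := LinearMap.congr_fun₂ this x y
      simpa using this
    have hco : ∀ x y z, ν x (J w y z) + ν y (J w z x) + ν z (J w x y)
        + J w x (ν y z) + J w y (ν z x) + J w z (ν x y) = 0 := by
      have h0 : ∀ i j z, ν (e i) (J w (e j) z) + ν (e j) (J w z (e i)) + ν z (J w (e i) (e j))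
          + J w (e i) (ν (e j) z) + J w (e j) (ν z (e i)) + J w z (ν (e i) (e j)) = 0 := by
        intro i j z
        rw [← e.sum_repr z]
        simp only [map_sum, map_smul, _root_.sum_apply,
          _root_.smul_apply, ← Finset.sum_add_distrib, ← smul_add]
        exact Finset.sum_eq_zero fun k _ => by rw [hw2 i j k, smul_zero]
      have h1 : ∀ i y z, ν (e i) (J w y z) + ν y (J w z (e i)) + ν z (J w (e i) y)
          + J w (e i) (ν y z) + J w y (ν z (e i)) + J w z (ν (e i) y) = 0 := by
        intro i y z
        rw [← e.sum_repr y]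
        simp only [map_sum, map_smul, _root_.sum_apply,
          _root_.smul_apply, ← Finset.sum_add_distrib, ← smul_add]
        exact Finset.sum_eq_zero fun k _ => by rw [h0 i k z, smul_zero]
      intro x y z
      rw [← e.sum_repr x]
      simp only [map_sum, map_smul, _root_.sum_apply,
        _root_.smul_apply, ← Finset.sum_add_distrib, ← smul_add]
      exact Finset.sum_eq_zero fun k _ => by rw [h1 k y z, smul_zero]
    obtain ⟨a, ha⟩ := whitehead2 hν hB (tl (J w)) halt (by
      intro x y z
      rw [← hco x y z]
      simp only [tl_apply]
      rw [halt (ν x y) z, halt (ν y z) x, halt (ν z x) y]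
      abel)
    have hwR : J w ∈ R := by
      refine ⟨LinearMap.toContinuousLinearMap a, fun x y => ?_⟩
      have h1 := ha x y
      have h2 := hν.skew y (a x)
      simp only [tl_apply] at h1 h2
      simp only [LinearMap.coe_toContinuousLinearMap']
      rw [h1, h2]; abel
    exact hJ2 w hwR
  have hDD := LinearMap.exists_antilipschitzWith (𝕜 := ℝ) (E := (EuclideanSpace ℝ (Fin dW)))
    (F := (ι → ι → V) × (ι → ι → ι → V)) D
  obtain ⟨K, hK0, hK⟩ := hDD hD
  have hKD : ∀ w : EuclideanSpace ℝ (Fin dW), ‖w‖ ≤ K * ‖D w‖ := by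
    intro w
    simpa using hK.le_mul_dist w 0
  -- the nonlinear map
  let G : (V →L[ℝ] V) × (EuclideanSpace ℝ (Fin dW)) × (V →L[ℝ] V →L[ℝ] V) → (ι → ι → V) × (V →L[ℝ] V →L[ℝ] V) :=
    fun p => (fun i j => p.1 (p.2.2 (e i) (e j)) - (ν + J p.2.1) (p.1 (e i)) (p.1 (e j)), p.2.2)
  let p0 : (V →L[ℝ] V) × (EuclideanSpace ℝ (Fin dW)) × (V →L[ℝ] V →L[ℝ] V) := (1, 0, ν)
  have hGp0 : G p0 = (0, ν) := by
    simp only [G, p0]; ext1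
    · funext i j; simp
    · rfl
  have hG : ∃ G' : ((V →L[ℝ] V) × (EuclideanSpace ℝ (Fin dW)) × (V →L[ℝ] V →L[ℝ] V)) →L[ℝ]
      (ι → ι → V) × (V →L[ℝ] V →L[ℝ] V), HasStrictFDerivAt G G' p0 ∧ ∀ a w m,
        G' (a, w, m) = (fun i j => a (ν (e i) (e j)) + m (e i) (e j) - J w (e i) (e j)
          - ν (a (e i)) (e j) - ν (e i) (a (e j)), m) := by
    let P1 := ContinuousLinearMap.fst ℝ (V →L[ℝ] V) ((EuclideanSpace ℝ (Fin dW)) × (V →L[ℝ] V →L[ℝ] V))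
    let P2 := ContinuousLinearMap.snd ℝ (V →L[ℝ] V) ((EuclideanSpace ℝ (Fin dW)) × (V →L[ℝ] V →L[ℝ] V))
    let Q1 := J.comp ((ContinuousLinearMap.fst ℝ (EuclideanSpace ℝ (Fin dW)) (V →L[ℝ] V →L[ℝ] V)).comp P2)
    let Q2 := (ContinuousLinearMap.snd ℝ (EuclideanSpace ℝ (Fin dW)) (V →L[ℝ] V →L[ℝ] V)).comp P2
    have d1 : HasStrictFDerivAt (fun p => P1 p) P1 p0 := P1.hasStrictFDerivAt
    have dq1 : HasStrictFDerivAt (fun p => ν + Q1 p) Q1 p0 := Q1.hasStrictFDerivAt.const_add ν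
    have dq2 : HasStrictFDerivAt (fun p => Q2 p) Q2 p0 := Q2.hasStrictFDerivAt
    have dc : ∀ v : V, HasStrictFDerivAt (𝕜 := ℝ) (fun _ : (V →L[ℝ] V) × (EuclideanSpace ℝ (Fin dW)) × (V →L[ℝ] V →L[ℝ] V) => v)
      0 p0 := fun v => hasStrictFDerivAt_const v p0
    have dij := fun i j => (d1.clm_apply ((dq2.clm_apply (dc (e i))).clm_apply (dc (e j)))).sub
      ((dq1.clm_apply (d1.clm_apply (dc (e i)))).clm_apply (d1.clm_apply (dc (e j))))
    have dall := (hasStrictFDerivAt_pi.2 fun i => hasStrictFDerivAt_pi.2 fun j => dij i j).prodMk dq2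
    refine ⟨_, dall, fun a w m => ?_⟩
    ext1
    · funext i j
      simp [P1, P2, Q1, Q2, p0]
      abel
    · simp [P1, P2, Q1, Q2, p0]
  obtain ⟨G', hGd, hG'⟩ := hG
  have hsurj : G'.range = ⊤ := by
    rw [LinearMap.range_eq_top]
    rintro ⟨c, m⟩
    let C : V →L[ℝ] V →L[ℝ] V :=
      ct (e.toBasis.constr ℝ fun i => e.toBasis.constr ℝ fun j => m (e i) (e j) - c i j)
    have hC : ∀ i j, C (e i) (e j) = m (e i) (e j) - c i j := by
      intro i j
      have h1 := e.toBasis.constr_basis ℝ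
        (fun i => e.toBasis.constr ℝ fun j => m (e i) (e j) - c i j) i
      have h2 := e.toBasis.constr_basis ℝ (fun j => m (e i) (e j) - c i j) j
      simp only [OrthonormalBasis.coe_toBasis] at h1 h2
      simp only [C, ct_apply, h1, h2]
    obtain ⟨r, ⟨a, ha⟩, w, hrw⟩ := hJ1 C
    refine ⟨(a, w, m), ?_⟩
    change G' (a, w, m) = _
    rw [hG']
    ext1
    · funext i j
      have h1 := hC i j
      rw [← hrw] at h1
      simp only [_root_.add_apply, ha] at h1
      have h2 : c i j = m (e i) (e j) - (ν (e i) (a (e j)) + ν (a (e i)) (e j)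
        - a (ν (e i) (e j)) + J w (e i) (e j)) := by rw [h1]; abel
      simp only
      rw [h2]; abel
    · rfl
  have hmap := hGd.map_nhds_eq_of_surj hsurj
  rw [hGp0] at hmap
  let ε : ℝ := 1 / (3 * K * ‖J‖ ^ 2 + 1)
  have hKp : (0:ℝ) < K := hK0
  have hε : 0 < ε := by positivity
  have hS : ∀ᶠ p in 𝓝 p0, IsUnit p.1 ∧ ‖p.2.1‖ < ε := by
    apply Filter.Eventually.and
    · have h1 : ∀ᶠ g : V →L[ℝ] V in 𝓝 1, IsUnit g := Units.isOpen.mem_nhds isUnit_one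
      exact (continuous_fst.tendsto p0).eventually h1
    · have h1 : Continuous fun p : (V →L[ℝ] V) × (EuclideanSpace ℝ (Fin dW)) × (V →L[ℝ] V →L[ℝ] V) => ‖p.2.1‖ := by fun_prop
      have h2 := (h1.tendsto p0)
      exact h2.eventually (gt_mem_nhds (by simpa [p0] using hε))
  have hev : ∀ᶠ q in 𝓝 ((0, ν) : (ι → ι → V) × (V →L[ℝ] V →L[ℝ] V)),
      ∃ p, (IsUnit p.1 ∧ ‖p.2.1‖ < ε) ∧ G p = q := by
    rw [← hmap]
    exact Filter.eventually_map.2 (hS.mono fun p hp => ⟨p, hp, rfl⟩)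
  have hcont : Continuous fun μ : V →L[ℝ] V →L[ℝ] V => ((0, μ) : (ι → ι → V) × _) := by fun_prop
  refine ((hcont.tendsto ν).eventually hev).mono ?_
  rintro μ ⟨⟨g, w, μ'⟩, ⟨⟨u, hu⟩, hwε⟩, hGp⟩ hμ
  have hμ' : μ' = μ := congrArg Prod.snd hGp
  subst hμ'
  simp only at hu hwε
  have hgb : ∀ i j, g (μ' (e i) (e j)) = (ν + J w) (g (e i)) (g (e j)) := fun i j =>
    sub_eq_zero.1 (congrFun (congrFun (congrArg Prod.fst hGp) i) j)
  let ge : V ≃ₗ[ℝ] V := (ContinuousLinearEquiv.unitsEquiv ℝ V u).toLinearEquiv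
  have hge : ∀ x, ge x = g x := by
    intro x; rw [← hu]; rfl
  have hgall : ∀ x y, ge (μ' x y) = (ν + J w) (ge x) (ge y) := by
    have : (tl μ').compr₂ ge.toLinearMap = (tl (ν + J w)).compl₁₂ ge.toLinearMap ge.toLinearMap :=
      bil_ext e fun i j => by simpa [hge] using hgb i j
    intro x y
    have := LinearMap.congr_fun₂ this x y
    simpa using this
  have hLie : IsLieBr (tl (ν + J w)) := hμ.transfer ge hgall
  have hw0 : w = 0 := by
    have halt : ∀ x y, J w x y + J w y x = 0 := by
      intro x y
      have h1 := hLie.skew x y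
      have h2 := hν.skew x y
      simp only [tl_apply, _root_.add_apply] at h1 h2
      rw [h2] at h1
      have h3 : J w x y + J w y x = (-ν y x + J w x y) + (ν y x + J w y x) := by abel
      rw [h3, h1]; abel
    have hcyc : ∀ {η : V →ₗ[ℝ] V →ₗ[ℝ] V} (_ : IsLieBr η) (x y z : V),
        η x (η y z) + η y (η z x) + η z (η x y) = 0 := by
      intro η h x y z
      rw [h.jac x y z, h.skew (η x y) z, h.skew z x, map_neg]; abel
    have hJ : ∀ x y z, ν x (J w y z) + ν y (J w z x) + ν z (J w x y)
        + J w x (ν y z) + J w y (ν z x) + J w z (ν x y)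
        = - (J w x (J w y z) + J w y (J w z x) + J w z (J w x y)) := by
      intro x y z
      have h1 := hcyc hLie x y z
      have h2 := hcyc hν x y z
      simp only [tl_apply, _root_.add_apply, map_add] at h1 h2
      rw [← sub_eq_zero, ← sub_eq_zero.2 (h1.trans h2.symm)]
      abel
    have hb : ∀ i j k, ‖J w (e i) (J w (e j) (e k))‖ ≤ (‖J‖ * ‖w‖) * (‖J‖ * ‖w‖) := by
      intro i j k
      calc ‖J w (e i) (J w (e j) (e k))‖ ≤ ‖J w‖ * ‖e i‖ * ‖J w (e j) (e k)‖ := (J w).le_opNorm₂ _ _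
        _ ≤ ‖J w‖ * ‖e i‖ * (‖J w‖ * ‖e j‖ * ‖e k‖) := by
          gcongr; exact (J w).le_opNorm₂ _ _
        _ = ‖J w‖ * ‖J w‖ := by simp
        _ ≤ (‖J‖ * ‖w‖) * (‖J‖ * ‖w‖) := by
          gcongr <;> exact J.le_opNorm w
    have hDw : ‖D w‖ ≤ 3 * ((‖J‖ * ‖w‖) * (‖J‖ * ‖w‖)) := by
      have hpos : 0 ≤ 3 * ((‖J‖ * ‖w‖) * (‖J‖ * ‖w‖)) := by positivity
      rw [Prod.norm_def, max_le_iff]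
      constructor
      · refine (pi_norm_le_iff_of_nonneg hpos).2 fun i => (pi_norm_le_iff_of_nonneg hpos).2 fun j => ?_
        have : (D w).1 i j = 0 := halt _ _
        rw [this, norm_zero]; exact hpos
      · refine (pi_norm_le_iff_of_nonneg hpos).2 fun i => (pi_norm_le_iff_of_nonneg hpos).2
          fun j => (pi_norm_le_iff_of_nonneg hpos).2 fun k => ?_
        have : (D w).2 i j k = _ := hJ (e i) (e j) (e k)
        rw [this, norm_neg]
        refine (norm_add₃_le).trans ?_
        linarith [hb i j k, hb j k i, hb k i j]
    by_contra hne
    have hpos : 0 < ‖w‖ := norm_pos_iff.2 hne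
    have h1 := hKD w
    have h2 : ‖w‖ ≤ 3 * K * ‖J‖ ^ 2 * ‖w‖ * ‖w‖ := by
      calc ‖w‖ ≤ K * ‖D w‖ := h1
        _ ≤ K * (3 * ((‖J‖ * ‖w‖) * (‖J‖ * ‖w‖))) := by gcongr
        _ = _ := by ring
    have h3 : (3 * K * ‖J‖ ^ 2 + 1) * ‖w‖ < 1 := by
      have := hwε
      rw [lt_div_iff₀ (by positivity)] at this
      linarith
    nlinarith
  refine ⟨ge, fun x y => ?_⟩
  rw [hgall, hw0]; simp
end rigid

section minim
open Filter Topology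
open scoped InnerProductSpace
variable {V : Type*} [NormedAddCommGroup V] [InnerProductSpace ℝ V]

theorem kf_transfer {A B : Type*} [AddCommGroup A] [Module ℝ A] [AddCommGroup B] [Module ℝ B]
    {μ : A →ₗ[ℝ] A →ₗ[ℝ] A} {ν : B →ₗ[ℝ] B →ₗ[ℝ] B} (g : A ≃ₗ[ℝ] B)
    (hg : ∀ x y, g (μ x y) = ν (g x) (g y)) (x y : A) : kf μ x y = kf ν (g x) (g y) := by
  rw [kf_apply, kf_apply, ← LinearMap.trace_conj' _ g]
  congr 1
  ext u
  obtain ⟨u, rfl⟩ := g.surjective u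
  simp [LinearEquiv.conj_apply, hg]

/-- Gram determinant of the Killing form. -/
noncomputable def kdet {ι : Type*} [Fintype ι] [DecidableEq ι] (e : OrthonormalBasis ι ℝ V)
    (ν : V →L[ℝ] V →L[ℝ] V) : ℝ :=
  (Matrix.of fun i j => ∑ k, ⟪e k, ν (e i) (ν (e j) (e k))⟫_ℝ).det

theorem kdet_eq {ι : Type*} [Fintype ι] [DecidableEq ι] (e : OrthonormalBasis ι ℝ V)
    (ν : V →L[ℝ] V →L[ℝ] V) :
    kdet e ν = (LinearMap.BilinForm.toMatrix e.toBasis (kf (tl ν))).det := by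
  unfold kdet
  congr 1
  ext i j
  rw [LinearMap.BilinForm.toMatrix_apply, kf_apply, LinearMap.trace_eq_sum_inner _ e]
  simp

theorem kdet_continuous {ι : Type*} [Fintype ι] [DecidableEq ι] (e : OrthonormalBasis ι ℝ V) :
    Continuous (kdet e) := by
  unfold kdet
  apply Continuous.matrix_det
  apply continuous_matrix
  intro i j
  simp only [Matrix.of_apply]
  fun_prop

theorem kdet_transfer {ι : Type*} [Fintype ι] [DecidableEq ι] (e : OrthonormalBasis ι ℝ V)
    {μ ν : V →L[ℝ] V →L[ℝ] V} (g : V ≃ₗ[ℝ] V)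
    (hg : ∀ x y, g (μ x y) = ν (g x) (g y)) :
    kdet e μ = (LinearMap.det g.toLinearMap) ^ 2 * kdet e ν := by
  have h : kf (tl μ) = (kf (tl ν)).comp g.toLinearMap g.toLinearMap := by
    ext x y
    exact kf_transfer (μ := tl μ) (ν := tl ν) g hg x y
  rw [kdet_eq, kdet_eq, h, LinearMap.BilinForm.toMatrix_comp e.toBasis e.toBasis, Matrix.det_mul,
    Matrix.det_mul, Matrix.det_transpose, LinearMap.det_toMatrix]
  ring

/-- Squared norm of a bilinear map. -/
noncomputable def qn {ι : Type*} [Fintype ι] (e : OrthonormalBasis ι ℝ V)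
    (ν : V →L[ℝ] V →L[ℝ] V) : ℝ := ∑ i, ∑ j, ‖ν (e i) (e j)‖ ^ 2

theorem qn_continuous {ι : Type*} [Fintype ι] (e : OrthonormalBasis ι ℝ V) :
    Continuous (qn e) := by
  unfold qn
  fun_prop

theorem qn_smul {ι : Type*} [Fintype ι] (e : OrthonormalBasis ι ℝ V) (s : ℝ)
    (ν : V →L[ℝ] V →L[ℝ] V) : qn e (s • ν) = s ^ 2 * qn e ν := by
  unfold qn
  simp [norm_smul, mul_pow, Finset.mul_sum]

theorem qn_nonneg {ι : Type*} [Fintype ι] (e : OrthonormalBasis ι ℝ V)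
    (ν : V →L[ℝ] V →L[ℝ] V) : 0 ≤ qn e ν := by
  unfold qn
  positivity

theorem qn_pos {ι : Type*} [Fintype ι] (e : OrthonormalBasis ι ℝ V)
    {ν : V →L[ℝ] V →L[ℝ] V} (h : ν ≠ 0) : 0 < qn e ν := by
  refine lt_of_le_of_ne (qn_nonneg e ν) fun h0 => h ?_
  have h1 : ∀ i j, ν (e i) (e j) = 0 := by
    intro i j
    have h2 := (Finset.sum_eq_zero_iff_of_nonneg (fun i _ => by positivity)).1 h0.symm i
      (Finset.mem_univ i)
    have h3 := (Finset.sum_eq_zero_iff_of_nonneg (fun i _ => by positivity)).1 h2 j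
      (Finset.mem_univ j)
    simpa using h3
  have h2 : tl ν = 0 := bil_ext e fun i j => by simpa using h1 i j
  ext x y
  exact LinearMap.congr_fun₂ h2 x y

theorem qn_compact [FiniteDimensional ℝ V] {ι : Type*} [Fintype ι] (e : OrthonormalBasis ι ℝ V) :
    IsCompact {ν : V →L[ℝ] V →L[ℝ] V | qn e ν = 1} := by
  let f : (V →L[ℝ] V →L[ℝ] V) →ₗ[ℝ] (ι → ι → V) :=
    { toFun := fun ν i j => ν (e i) (e j)
      map_add' := by intro a b; funext i j; simp
      map_smul' := by intro a b; funext i j; simp }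
  have hf : f.ker = ⊥ := by
    rw [LinearMap.ker_eq_bot']
    intro ν h
    by_contra hne
    have := qn_pos e hne
    have h1 : ∀ i j, ν (e i) (e j) = 0 := fun i j => congrFun (congrFun h i) j
    simp [qn, h1] at this
  have hc := LinearMap.isClosedEmbedding_of_injective hf
  have hK : IsCompact (Metric.closedBall (0 : ι → ι → V) 1) := isCompact_closedBall _ _
  refine (hc.isCompact_preimage hK).of_isClosed_subset
    (isClosed_eq (qn_continuous e) continuous_const) ?_
  intro ν hν
  simp only [Set.mem_preimage, mem_closedBall_zero_iff]
  refine (pi_norm_le_iff_of_nonneg zero_le_one).2 fun i =>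
    (pi_norm_le_iff_of_nonneg zero_le_one).2 fun j => ?_
  have h1 : ‖ν (e i) (e j)‖ ^ 2 ≤ qn e ν :=
    (Finset.single_le_sum (f := fun j => ‖ν (e i) (e j)‖ ^ 2) (fun j _ => by positivity)
      (Finset.mem_univ j)).trans
    (Finset.single_le_sum (f := fun i => ∑ j, ‖ν (e i) (e j)‖ ^ 2) (fun j _ => by positivity)
      (Finset.mem_univ i))
  rw [hν] at h1
  change ‖ν (e i) (e j)‖ ≤ 1
  nlinarith [norm_nonneg (ν (e i) (e j))]

theorem isLieBr_closed : IsClosed {ν : V →L[ℝ] V →L[ℝ] V | IsLieBr (tl ν)} := by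
  have : {ν : V →L[ℝ] V →L[ℝ] V | IsLieBr (tl ν)} =
      (⋂ x : V, {ν | ν x x = 0}) ∩
      ⋂ x : V, ⋂ y : V, ⋂ z : V, {ν | ν x (ν y z) = ν (ν x y) z + ν y (ν x z)} := by
    ext ν
    simp only [Set.mem_ofPred_eq, Set.mem_inter_iff, Set.mem_iInter]
    exact ⟨fun h => ⟨h.alt, h.jac⟩, fun h => ⟨h.1, h.2⟩⟩
  rw [this]
  refine IsClosed.inter (isClosed_iInter fun x => isClosed_eq (by fun_prop) (by fun_prop)) ?_
  exact isClosed_iInter fun x => isClosed_iInter fun y => isClosed_iInter fun z =>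
    isClosed_eq (by fun_prop) (by fun_prop)

theorem exists_min [FiniteDimensional ℝ V] {ι : Type*} [Fintype ι]
    (e : OrthonormalBasis ι ℝ V) (ν₀ : V →L[ℝ] V →L[ℝ] V) (h0 : ν₀ ≠ 0)
    (hν₀ : IsLieBr (tl ν₀)) (hk : (kf (tl ν₀)).Nondegenerate) :
    ∃ ν : V →L[ℝ] V →L[ℝ] V, (∃ φ : V ≃ₗ[ℝ] V, ∀ x y, φ (ν₀ x y) = ν (φ x) (φ y)) ∧
      qn e ν = 1 ∧ ∀ (ν' : V →L[ℝ] V →L[ℝ] V) (q : V ≃ₗ[ℝ] V),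
        (∀ x y, q (ν' x y) = ν (q x) (q y)) →
        (LinearMap.det q.toLinearMap) ^ 2 ≤ qn e ν' ^ Fintype.card ι := by
  classical
  let O : Set (V →L[ℝ] V →L[ℝ] V) := {ν | ∃ φ : V ≃ₗ[ℝ] V, ∀ x y, φ (ν₀ x y) = ν (φ x) (φ y)}
  have hne : ∀ ν ∈ O, ν ≠ 0 := by
    rintro ν ⟨φ, hφ⟩ rfl
    apply h0
    ext x y
    simpa using hφ x y
  have hsc : ∀ ν ∈ O, ∀ s : ℝ, s ≠ 0 → s • ν ∈ O := by
    rintro ν ⟨φ, hφ⟩ s hs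
    refine ⟨φ.trans (LinearEquiv.smulOfNeZero ℝ V s⁻¹ (inv_ne_zero hs)), fun x y => ?_⟩
    simp [hφ, smul_smul, hs]
  have hnorm : ∀ ν ∈ O, ((Real.sqrt (qn e ν))⁻¹ • ν) ∈ O ∧
      qn e ((Real.sqrt (qn e ν))⁻¹ • ν) = 1 := by
    intro ν hν
    have hp := qn_pos e (hne ν hν)
    refine ⟨hsc ν hν _ (by positivity), ?_⟩
    rw [qn_smul, inv_pow, Real.sq_sqrt hp.le, inv_mul_cancel₀ hp.ne']
  have hdet_smul : ∀ (s : ℝ) (_ : s ≠ 0) (ν : V →L[ℝ] V →L[ℝ] V),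
      kdet e (s • ν) = (s ^ 2) ^ Fintype.card ι * kdet e ν := by
    intro s hs ν
    rw [kdet_transfer e (μ := s • ν) (ν := ν) (LinearEquiv.smulOfNeZero ℝ V s hs)
      (fun x y => by simp)]
    have : (LinearEquiv.smulOfNeZero ℝ V s hs).toLinearMap = s • LinearMap.id := by ext; simp
    rw [this, LinearMap.det_smul, LinearMap.det_id, Module.finrank_eq_card_basis e.toBasis]
    ring
  have hkO : ∀ ν ∈ O, kdet e ν ≠ 0 := by
    rintro ν ⟨φ, hφ⟩ hz
    have h1 := kdet_transfer e φ hφ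
    rw [hz, mul_zero, kdet_eq] at h1
    exact (LinearMap.BilinForm.nondegenerate_iff_det_ne_zero e.toBasis).1 hk h1
  have hO0 : ν₀ ∈ O := ⟨LinearEquiv.refl ℝ V, fun x y => rfl⟩
  have hC : IsCompact (closure O ∩ {ν | qn e ν = 1}) := (qn_compact e).inter_left isClosed_closure
  obtain ⟨ν, ⟨hν1, hν2⟩, hmax⟩ := hC.exists_isMaxOn
    ⟨_, subset_closure (hnorm _ hO0).1, (hnorm _ hO0).2⟩
    (f := fun ν => |kdet e ν|) (kdet_continuous e).abs.continuousOn
  have hmax' : ∀ μ ∈ O, qn e μ = 1 → |kdet e μ| ≤ |kdet e ν| := fun μ h1 h2 =>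
    hmax ⟨subset_closure h1, h2⟩
  have hpos : 0 < |kdet e ν| :=
    (abs_pos.2 (hkO _ (hnorm _ hO0).1)).trans_le (hmax' _ (hnorm _ hO0).1 (hnorm _ hO0).2)
  have hLie : IsLieBr (tl ν) := by
    have : closure O ⊆ {ν | IsLieBr (tl ν)} := by
      apply closure_minimal _ isLieBr_closed
      rintro μ ⟨φ, hφ⟩
      exact hν₀.transfer φ hφ
    exact this hν1
  have hkν : (kf (tl ν)).Nondegenerate := by
    rw [LinearMap.BilinForm.nondegenerate_iff_det_ne_zero e.toBasis, ← kdet_eq]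
    exact abs_pos.1 hpos
  have hνO : ν ∈ O := by
    obtain ⟨μ, ⟨φ, hφ⟩, hr⟩ := ((mem_closure_iff_frequently.1 hν1).and_eventually
      (rigid e ν hLie hkν)).exists
    obtain ⟨g, hg⟩ := hr (hν₀.transfer φ hφ)
    exact ⟨φ.trans g, fun x y => by simp [hφ, hg]⟩
  refine ⟨ν, hνO, hν2, fun ν' q hq => ?_⟩
  have hν'O : ν' ∈ O := by
    obtain ⟨φ, hφ⟩ := hνO
    refine ⟨φ.trans q.symm, fun x y => ?_⟩
    apply q.injective
    simp [hq, hφ]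
  obtain ⟨h1, h2⟩ := hnorm ν' hν'O
  have hp := qn_pos e (hne ν' hν'O)
  have h3 := hmax' _ h1 h2
  rw [hdet_smul _ (by positivity), kdet_transfer e q hq, inv_pow, Real.sq_sqrt hp.le, abs_mul,
    abs_mul, abs_of_nonneg (by positivity), abs_of_nonneg (by positivity), ← mul_assoc] at h3
  have h4 : (qn e ν')⁻¹ ^ Fintype.card ι * (LinearMap.det q.toLinearMap) ^ 2 ≤ 1 := by
    by_contra! hlt
    nlinarith
  rw [inv_pow, inv_mul_le_iff₀ (by positivity)] at h4
  simpa using h4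

/-- Infinitesimal action of an endomorphism on bilinear maps. -/
noncomputable def act (S : V →ₗ[ℝ] V) (ν : V →ₗ[ℝ] V →ₗ[ℝ] V) : V →ₗ[ℝ] V →ₗ[ℝ] V :=
  ν.compr₂ S - ν.compl₁₂ S LinearMap.id - ν.compl₁₂ LinearMap.id S

theorem act_apply (S : V →ₗ[ℝ] V) (ν : V →ₗ[ℝ] V →ₗ[ℝ] V) (x y : V) :
    act S ν x y = S (ν x y) - ν (S x) y - ν x (S y) := rfl

/-- Inner product of bilinear maps. -/
noncomputable def ipb {ι : Type*} [Fintype ι] (e : OrthonormalBasis ι ℝ V)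
    (μ ν : V →ₗ[ℝ] V →ₗ[ℝ] V) : ℝ := ∑ i, ∑ j, ⟪μ (e i) (e j), ν (e i) (e j)⟫_ℝ

theorem sum_adjoint [FiniteDimensional ℝ V] {ι : Type*} [Fintype ι] (e : OrthonormalBasis ι ℝ V)
    (A f g : V →ₗ[ℝ] V) :
    ∑ i, ⟪f (A (e i)), g (e i)⟫_ℝ = ∑ i, ⟪f (e i), g (A.adjoint (e i))⟫_ℝ := by
  have h1 : ∀ i, f (A (e i)) = ∑ k, ⟪e k, A (e i)⟫_ℝ • f (e k) := fun i => by
    conv_lhs => rw [← e.sum_repr' (A (e i))]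
    simp
  have h2 : ∀ i, g (A.adjoint (e i)) = ∑ k, ⟪e k, A.adjoint (e i)⟫_ℝ • g (e k) := fun i => by
    conv_lhs => rw [← e.sum_repr' (A.adjoint (e i))]
    simp
  simp only [h1, h2, sum_inner, inner_sum, inner_smul_left, inner_smul_right]
  rw [Finset.sum_comm]
  refine Finset.sum_congr rfl fun i _ => Finset.sum_congr rfl fun j _ => ?_
  rw [LinearMap.adjoint_inner_right, real_inner_comm (A (e j))]
  simp

theorem ipb_adjoint [FiniteDimensional ℝ V] {ι : Type*} [Fintype ι] (e : OrthonormalBasis ι ℝ V)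
    (A : V →ₗ[ℝ] V) (μ ν : V →ₗ[ℝ] V →ₗ[ℝ] V) :
    ipb e (act A μ) ν = ipb e μ (act A.adjoint ν) := by
  unfold ipb
  simp only [act_apply, inner_sub_left, inner_sub_right, Finset.sum_sub_distrib,
    LinearMap.adjoint_inner_right]
  congr 1
  · congr 1
    rw [Finset.sum_comm, Finset.sum_comm (f := fun i j => ⟪μ (e i) (e j), ν (A.adjoint (e i)) (e j)⟫_ℝ)]
    exact Finset.sum_congr rfl fun j _ => sum_adjoint e A (μ.flip (e j)) (ν.flip (e j))
  · exact Finset.sum_congr rfl fun i _ => sum_adjoint e A (μ (e i)) (ν (e i))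

theorem act_comm (A B : V →ₗ[ℝ] V) (ν : V →ₗ[ℝ] V →ₗ[ℝ] V) :
    act (A * B - B * A) ν = act A (act B ν) - act B (act A ν) := by
  ext x y
  simp only [act_apply, LinearMap.sub_apply, Module.End.mul_apply, map_sub]
  abel

theorem ipb_self_eq_zero {ι : Type*} [Fintype ι] (e : OrthonormalBasis ι ℝ V)
    {ν : V →ₗ[ℝ] V →ₗ[ℝ] V} (h : ipb e ν ν = 0) : ν = 0 := by
  refine bil_ext e fun i j => ?_
  have h2 := (Finset.sum_eq_zero_iff_of_nonneg (fun i _ => Finset.sum_nonneg fun j _ =>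
    real_inner_self_nonneg)).1 h i (Finset.mem_univ i)
  have h3 := (Finset.sum_eq_zero_iff_of_nonneg (fun j _ => real_inner_self_nonneg)).1 h2 j
    (Finset.mem_univ j)
  simpa using h3

theorem adjoint_deriv [FiniteDimensional ℝ V] {ι : Type*} [Fintype ι] (e : OrthonormalBasis ι ℝ V)
    {ν : V →ₗ[ℝ] V →ₗ[ℝ] V}
    (hc : ∀ S : V →ₗ[ℝ] V, LinearMap.trace ℝ V S = 0 → ipb e ν (act S ν) = 0)
    (D : V →ₗ[ℝ] V) (hD : act D ν = 0) : act D.adjoint ν = 0 := by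
  apply ipb_self_eq_zero e
  have h1 := hc (D * D.adjoint - D.adjoint * D) (by
    rw [map_sub, LinearMap.trace_mul_comm, sub_self])
  rw [act_comm, hD] at h1
  have h2 : act D.adjoint (0 : V →ₗ[ℝ] V →ₗ[ℝ] V) = 0 := by
    ext x y; simp [act_apply]
  rw [h2, sub_zero] at h1
  have h3 := ipb_adjoint e D.adjoint ν (act D.adjoint ν)
  rw [LinearMap.adjoint_adjoint] at h3
  rw [h3, h1]

theorem det_deriv {ι : Type*} [Fintype ι] [DecidableEq ι] (e : OrthonormalBasis ι ℝ V)
    (S : V →ₗ[ℝ] V) :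
    HasDerivAt (fun t : ℝ => LinearMap.det (1 + t • S)) (LinearMap.trace ℝ V S) 0 := by
  have h : ∀ t : ℝ, LinearMap.det (1 + t • S)
      = (1 + t • LinearMap.toMatrix e.toBasis e.toBasis S).det := by
    intro t
    rw [← LinearMap.det_toMatrix e.toBasis, map_add, map_smul, LinearMap.toMatrix_one]
  have h' := funext fun t : ℝ => (h t).trans (Matrix.det_one_add_smul t _)
  rw [h']
  rw [LinearMap.trace_eq_matrix_trace ℝ e.toBasis]
  set a := (LinearMap.toMatrix e.toBasis e.toBasis S).trace
  set P := (1 + (Polynomial.X : Polynomial ℝ) •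
    (LinearMap.toMatrix e.toBasis e.toBasis S).map Polynomial.C).det.divX.divX
  have h1 := (((hasDerivAt_id (0:ℝ)).const_mul a).const_add 1).add
    ((P.hasDerivAt 0).mul ((hasDerivAt_id (0:ℝ)).pow 2))
  convert! h1 using 1
  simp

set_option maxSynthPendingDepth 6 in
theorem critical [FiniteDimensional ℝ V] {ι : Type*} [Fintype ι] (e : OrthonormalBasis ι ℝ V)
    (ν : V →L[ℝ] V →L[ℝ] V) (hq : qn e ν = 1)
    (hmin : ∀ (ν' : V →L[ℝ] V →L[ℝ] V) (q : V ≃ₗ[ℝ] V),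
        (∀ x y, q (ν' x y) = ν (q x) (q y)) →
        (LinearMap.det q.toLinearMap) ^ 2 ≤ qn e ν' ^ Fintype.card ι)
    (S : V →ₗ[ℝ] V) (hS : LinearMap.trace ℝ V S = 0) : ipb e (tl ν) (act S (tl ν)) = 0 := by
  classical
  have : CompleteSpace V := FiniteDimensional.complete ℝ _
  have : CompleteSpace (V →L[ℝ] V) := FiniteDimensional.complete ℝ _
  have hcard : Fintype.card ι ≠ 0 := by
    intro h
    have := Fintype.card_eq_zero_iff.1 h
    simp [qn] at hq
  let T : V →L[ℝ] V := LinearMap.toContinuousLinearMap S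
  let q : ℝ → V →L[ℝ] V := fun t => 1 + t • T
  let R : ℝ → V →L[ℝ] V := fun t => Ring.inverse (q t)
  have hqd : HasDerivAt q T 0 := by
    have h1 := ((hasDerivAt_id (0:ℝ)).smul_const T).const_add (1 : V →L[ℝ] V)
    rw [one_smul] at h1
    exact h1
  have hq0 : q 0 = 1 := by simp [q]
  have hR0 : R 0 = 1 := by simp [R, hq0]
  have hRd : HasDerivAt R (-T) 0 := by
    have h1 := hasFDerivAt_ringInverse (𝕜 := ℝ) (1 : (V →L[ℝ] V)ˣ)
    rw [Units.val_one, ← hq0] at h1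
    have h2 := h1.comp_hasDerivAt (0:ℝ) hqd
    have h3 : (-((ContinuousLinearMap.mulLeftRight ℝ (V →L[ℝ] V))
      ↑(1 : (V →L[ℝ] V)ˣ)⁻¹) ↑(1 : (V →L[ℝ] V)ˣ)⁻¹) T = -T := by simp
    rw [h3] at h2
    exact h2
  let n : ι → ι → ℝ → V := fun i j t => R t (ν (q t (e i)) (q t (e j)))
  have hn : ∀ i j, HasDerivAt (n i j) (- act S (tl ν) (e i) (e j)) 0 := by
    intro i j
    have hqe : ∀ i, HasDerivAt (fun t => q t (e i)) (T (e i)) 0 := fun i => by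
      simpa using hqd.clm_apply (hasDerivAt_const (0:ℝ) (e i))
    have hν : HasDerivAt (fun t => ν (q t (e i)) (q t (e j)))
        (ν (T (e i)) (e j) + ν (e i) (T (e j))) 0 := by
      have h1 := (ν.hasFDerivAt (x := q 0 (e i))).comp_hasDerivAt (0:ℝ) (hqe i)
      have h2 := h1.clm_apply (hqe j)
      simpa [hq0] using h2
    have h3 := hRd.clm_apply hν
    convert! h3 using 1
    simp only [hR0, hq0, act_apply, tl_apply, T]
    simp
    abel
  have hQ : HasDerivAt (fun t => ∑ i, ∑ j, ‖n i j t‖ ^ 2)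
      (-2 * ipb e (tl ν) (act S (tl ν))) 0 := by
    have h1 := HasDerivAt.fun_sum (u := Finset.univ) fun i _ =>
      HasDerivAt.fun_sum (u := Finset.univ) fun j _ => (hn i j).norm_sq
    convert! h1 using 1
    simp [ipb, n, hR0, hq0, Finset.mul_sum]
  have hQ0 : ∑ i, ∑ j, ‖n i j 0‖ ^ 2 = 1 := by
    rw [← hq]; simp [n, hR0, hq0, qn]
  let H : ℝ → ℝ := fun t => (∑ i, ∑ j, ‖n i j t‖ ^ 2) ^ Fintype.card ι
    - LinearMap.det (1 + t • S) ^ 2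
  have hH : HasDerivAt H (Fintype.card ι * (-2 * ipb e (tl ν) (act S (tl ν)))) 0 := by
    have h1 := (hQ.pow (Fintype.card ι)).sub ((det_deriv e S).pow 2)
    convert! h1 using 1
    simp [hQ0, hS]
  have hunit : ∀ᶠ t in 𝓝 (0:ℝ), IsUnit (q t) := by
    have h1 : ∀ᶠ g : V →L[ℝ] V in 𝓝 (q 0), IsUnit g := by
      rw [hq0]; exact Units.isOpen.mem_nhds isUnit_one
    exact hqd.continuousAt.eventually h1
  have hloc : IsLocalMin H 0 := by
    refine hunit.mono ?_
    rintro t ⟨u, hu⟩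
    have hH0 : H 0 = 0 := by
      simp only [H, hQ0]; simp
    rw [hH0]
    let qe : V ≃ₗ[ℝ] V := (ContinuousLinearEquiv.unitsEquiv ℝ V u).toLinearEquiv
    have hqe : ∀ x, qe x = q t x := by
      intro x; rw [← hu]; rfl
    have hRq : ∀ x, q t (R t x) = x := by
      intro x
      have : q t * R t = 1 := Ring.mul_inverse_cancel _ ⟨u, hu⟩
      exact congrArg (fun f : V →L[ℝ] V => f x) this
    have hν' := hmin (ct (((tl ν).compl₁₂ (q t).toLinearMap (q t).toLinearMap).compr₂
      (R t).toLinearMap)) qe (by intro x y; simp [hqe, hRq])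
    have hdet : qe.toLinearMap = 1 + t • S := by
      ext x
      change qe x = _
      rw [hqe]
      simp [q, T]
    rw [hdet] at hν'
    have hqn : qn e (ct (((tl ν).compl₁₂ (q t).toLinearMap (q t).toLinearMap).compr₂
      (R t).toLinearMap)) = ∑ i, ∑ j, ‖n i j t‖ ^ 2 := by
      simp [qn, n]
    rw [hqn] at hν'
    exact sub_nonneg.2 hν'
  have hz := hloc.hasDerivAt_eq_zero hH
  have hc : (Fintype.card ι : ℝ) ≠ 0 := by exact_mod_cast hcard
  have := (mul_eq_zero.1 hz).resolve_left hc
  linarith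

theorem exists_good [FiniteDimensional ℝ V] {ι : Type*} [Fintype ι]
    (e : OrthonormalBasis ι ℝ V) (ν₀ : V →L[ℝ] V →L[ℝ] V) (h0 : ν₀ ≠ 0)
    (hν₀ : IsLieBr (tl ν₀)) (hk : (kf (tl ν₀)).Nondegenerate) :
    ∃ ν : V →L[ℝ] V →L[ℝ] V, (∃ φ : V ≃ₗ[ℝ] V, ∀ x y, φ (ν₀ x y) = ν (φ x) (φ y)) ∧
      ∀ x, act (LinearMap.adjoint (tl ν x)) (tl ν) = 0 := by
  obtain ⟨ν, ⟨φ, hφ⟩, hq, hmin⟩ := exists_min e ν₀ h0 hν₀ hk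
  refine ⟨ν, ⟨φ, hφ⟩, fun x => ?_⟩
  have hL : IsLieBr (tl ν) := hν₀.transfer φ hφ
  apply adjoint_deriv e (critical e ν hq hmin)
  ext y z
  simp only [act_apply, hL.jac x y z]
  simp
end minim

section assembly
open scoped InnerProductSpace

theorem containsSU2_of {L : Type*} [LieRing L] [LieAlgebra ℝ L] {x y z : L} (hx : x ≠ 0)
    (h1 : ⁅x, y⁆ = z) (h2 : ⁅y, z⁆ = x) (h3 : ⁅z, x⁆ = y) : ContainsSU2 L := by
  refine ⟨x, y, z, ?_, h1, h2, h3⟩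
  have hz : z ≠ 0 := by
    rintro rfl
    exact hx (by rw [← h2, lie_zero])
  have h4 : ⁅x, z⁆ = -y := by rw [← lie_skew, h3]
  rw [Fintype.linearIndependent_iff]
  intro g hg
  simp only [Fin.sum_univ_three, Matrix.cons_val_zero, Matrix.cons_val_one, Matrix.cons_val] at hg
  have e1 := congrArg (fun v => ⁅x, v⁆) hg
  simp only [lie_add, lie_smul, h1, h4, lie_self, lie_zero] at e1
  have e2 := congrArg (fun v => ⁅x, v⁆) e1
  simp only [lie_add, lie_smul, h1, h4, lie_neg, lie_zero] at e2
  have e3 : (g 1 * g 1 + g 2 * g 2) • z = 0 := by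
    have : (g 1 * g 1 + g 2 * g 2) • z = g 1 • (g 0 • (0 : L) + g 1 • z + g 2 • -y)
      - g 2 • (g 0 • (0 : L) + g 1 • -y + g 2 • -z) := by module
    rw [this, e1, e2]; simp
  have e4 := (smul_eq_zero.1 e3).resolve_right hz
  have hb : g 1 = 0 := by nlinarith [mul_self_nonneg (g 1), mul_self_nonneg (g 2)]
  have hc : g 2 = 0 := by nlinarith [mul_self_nonneg (g 1), mul_self_nonneg (g 2)]
  rw [hb, hc] at hg
  simp only [zero_smul, add_zero] at hg
  have ha := (smul_eq_zero.1 hg).resolve_right hx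
  intro i
  fin_cases i
  · exact ha
  · exact hb
  · exact hc

theorem sl2_of {L : Type*} [LieRing L] [LieAlgebra ℝ L] {x y z : L} (hx : x ≠ 0)
    (h1 : ⁅x, y⁆ = z) (h2 : ⁅z, y⁆ = x) (h3 : ⁅z, x⁆ = -y)
    (hs : ∀ v, ∃ a b c : ℝ, v = a • x + b • y + c • z) :
    Nonempty (L ≃ₗ⁅ℝ⁆ LieAlgebra.SpecialLinear.sl (Fin 2) ℝ) := by
  have hz : z ≠ 0 := by
    rintro rfl
    exact hx (by rw [← h2, zero_lie])
  have h1' : ⁅y, x⁆ = -z := by rw [← lie_skew, h1]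
  have h2' : ⁅y, z⁆ = -x := by rw [← lie_skew, h2]
  have h3' : ⁅x, z⁆ = y := by rw [← lie_skew, h3, neg_neg]
  have htr : ∀ M : LieAlgebra.SpecialLinear.sl (Fin 2) ℝ, M.1 1 1 = - M.1 0 0 := by
    intro M
    have hM : M.1.trace = 0 := M.2
    rw [Matrix.trace_fin_two] at hM
    linarith
  let ψ : LieAlgebra.SpecialLinear.sl (Fin 2) ℝ →ₗ⁅ℝ⁆ L :=
    { toFun := fun M => (2 * M.1 0 0) • x + (M.1 0 1 + M.1 1 0) • y + (M.1 0 1 - M.1 1 0) • z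
      map_add' := by
        intro M N
        have hM : ∀ i j, (M + N).1 i j = M.1 i j + N.1 i j := fun i j => rfl
        simp only [hM]
        module
      map_smul' := by
        intro r M
        have hM : ∀ i j, (r • M).1 i j = r * M.1 i j := fun i j => rfl
        simp only [hM, RingHom.id_apply]
        module
      map_lie' := by
        intro M N
        simp only [LieAlgebra.SpecialLinear.sl_bracket, Matrix.sub_apply, Matrix.mul_apply,
          Fin.sum_univ_two, htr, lie_add, add_lie, lie_smul, smul_lie, lie_self, h1, h2, h3,
          h1', h2', h3']
        module }
  have hψ : ∀ M, ψ M = (2 * M.1 0 0) • x + (M.1 0 1 + M.1 1 0) • y + (M.1 0 1 - M.1 1 0) • z :=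
    fun M => rfl
  have hind : ∀ a b c : ℝ, a • x + b • y + c • z = 0 → a = 0 ∧ b = 0 ∧ c = 0 := by
    intro a b c h
    have e1 := congrArg (fun v => ⁅z, v⁆) h
    simp only [lie_add, lie_smul, h2, h3, lie_self, lie_zero] at e1
    have e2 := congrArg (fun v => ⁅z, v⁆) e1
    simp only [lie_add, lie_smul, h2, h3, lie_self, lie_zero, lie_neg] at e2
    have e3 : (a * a + b * b) • x = 0 := by
      have : (a * a + b * b) • x = b • (a • -y + b • x + c • (0:L))
        - a • (a • -x + b • -y + c • (0 : L)) := by module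
      rw [this, e1, e2]; simp
    have e4 := (smul_eq_zero.1 e3).resolve_right hx
    have ha : a = 0 := by nlinarith [mul_self_nonneg a, mul_self_nonneg b]
    have hb : b = 0 := by nlinarith [mul_self_nonneg a, mul_self_nonneg b]
    subst ha hb
    simp only [zero_smul, zero_add] at h
    exact ⟨rfl, rfl, (smul_eq_zero.1 h).resolve_right hz⟩
  refine ⟨(LieEquiv.ofBijective ψ ⟨?_, ?_⟩).symm⟩
  · rw [injective_iff_map_eq_zero]
    intro M hM
    rw [hψ] at hM
    obtain ⟨ha, hb, hc⟩ := hind _ _ _ hM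
    have h00 : M.1 0 0 = 0 := by linarith
    have h11 := htr M
    ext i j
    fin_cases i <;> fin_cases j <;> simp <;> linarith
  · intro v
    obtain ⟨a, b, c, rfl⟩ := hs v
    refine ⟨⟨!![a / 2, (b + c) / 2; (b - c) / 2, -(a / 2)], ?_⟩, ?_⟩
    · change Matrix.trace !![a / 2, (b + c) / 2; (b - c) / 2, -(a / 2)] = 0
      simp [Matrix.trace_fin_two]
    · rw [hψ]
      simp
      module

theorem main_alt (L : Type*) [LieRing L] [LieAlgebra ℝ L] [FiniteDimensional ℝ L]
    [LieAlgebra.IsSimple ℝ L] :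
    (∃ x y z : L, x ≠ 0 ∧ ⁅x, y⁆ = z ∧ ⁅y, z⁆ = x ∧ ⁅z, x⁆ = y) ∨
    (∃ x y z : L, x ≠ 0 ∧ ⁅x, y⁆ = z ∧ ⁅z, y⁆ = x ∧ ⁅z, x⁆ = -y ∧
      ∀ v, ∃ a b c : ℝ, v = a • x + b • y + c • z) := by
  let n := Module.finrank ℝ L
  let V := EuclideanSpace ℝ (Fin n)
  let φ₀ : L ≃ₗ[ℝ] V := LinearEquiv.ofFinrankEq _ _ (by simp [V, n])
  let μ : L →ₗ[ℝ] L →ₗ[ℝ] L := LinearMap.mk₂ ℝ (fun x y => ⁅x, y⁆)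
    add_lie smul_lie lie_add lie_smul
  have hμ : ∀ x y, μ x y = ⁅x, y⁆ := fun x y => rfl
  have hμL : IsLieBr μ := ⟨fun x => by rw [hμ, lie_self], fun x y z => by
    simp only [hμ]; rw [leibniz_lie]⟩
  let ν₀ : V →L[ℝ] V →L[ℝ] V :=
    ct ((μ.compl₁₂ φ₀.symm.toLinearMap φ₀.symm.toLinearMap).compr₂ φ₀.toLinearMap)
  have hφ₀ : ∀ x y, φ₀ (μ x y) = tl ν₀ (φ₀ x) (φ₀ y) := by
    intro x y; simp [ν₀]
  have hna : ∃ x y : L, ⁅x, y⁆ ≠ 0 := by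
    by_contra! hcon
    exact LieAlgebra.IsSimple.non_abelian (R := ℝ) (L := L) ⟨hcon⟩
  have h0 : ν₀ ≠ 0 := by
    intro h
    obtain ⟨x, y, hxy⟩ := hna
    apply hxy
    have := hφ₀ x y
    rw [h] at this
    simpa [hμ] using this
  have hk : (kf (tl ν₀)).Nondegenerate := by
    have : kf (tl ν₀) = LinearMap.BilinForm.congr φ₀ (killingForm ℝ L) := by
      ext x y
      obtain ⟨x, rfl⟩ := φ₀.surjective x
      obtain ⟨y, rfl⟩ := φ₀.surjective y
      rw [← kf_transfer φ₀ hφ₀, LinearMap.BilinForm.congr_apply, LinearEquiv.symm_apply_apply,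
        LinearEquiv.symm_apply_apply]
      rfl
    rw [this, LinearMap.BilinForm.nondegenerate_congr_iff]
    exact LieAlgebra.IsKilling.killingForm_nondegenerate ℝ L
  obtain ⟨ν, ⟨φ₁, hφ₁⟩, hst⟩ := exists_good (EuclideanSpace.basisFun (Fin n) ℝ) ν₀ h0
    (hμL.transfer φ₀ hφ₀) hk
  let φ : L ≃ₗ[ℝ] V := φ₀.trans φ₁
  have hφ : ∀ x y, φ ⁅x, y⁆ = tl ν (φ x) (φ y) := by
    intro x y
    have := hφ₀ x y
    simp only [hμ, tl_apply] at this
    simp only [φ, LinearEquiv.trans_apply, this, hφ₁, tl_apply]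
  have hφs : ∀ x y, φ.symm (tl ν x y) = ⁅φ.symm x, φ.symm y⁆ := by
    intro x y
    apply φ.injective
    rw [hφ]; simp
  have hL : IsLieBr (tl ν) := hμL.transfer φ hφ
  have hstar : ∀ x, ∃ y, ∀ u v, ⟪tl ν x u, v⟫_ℝ = ⟪u, tl ν y v⟫_ℝ := by
    intro x
    let A := LinearMap.adjoint (tl ν x)
    have hA : ∀ u v, A (tl ν u v) = tl ν (A u) v + tl ν u (A v) := by
      intro u v
      have := LinearMap.congr_fun₂ (hst x) u v
      rw [act_apply] at this
      rw [← sub_eq_zero, ← sub_sub]; exact this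
    let d : LieDerivation ℝ L L :=
      { toLinearMap := φ.symm.toLinearMap ∘ₗ A ∘ₗ φ.toLinearMap
        leibniz' := by
          intro a b
          simp only [LinearMap.comp_apply, LinearEquiv.coe_coe, hφ, hA, map_add, hφs,
            LinearEquiv.symm_apply_apply]
          rw [← lie_skew b]
          abel }
    obtain ⟨y, hy⟩ := LieDerivation.IsKilling.exists_eq_ad d
    refine ⟨φ y, fun u v => ?_⟩
    have h1 : ⁅y, φ.symm v⁆ = φ.symm (A v) := by
      rw [← LieDerivation.ad_apply_apply ℝ L, hy]
      change φ.symm (A (φ (φ.symm v))) = _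
      rw [LinearEquiv.apply_symm_apply]
    have h2 : tl ν (φ y) v = A v := by
      have := hφ y (φ.symm v)
      rw [h1, LinearEquiv.apply_symm_apply, LinearEquiv.apply_symm_apply] at this
      exact this.symm
    rw [h2]
    exact (LinearMap.adjoint_inner_right _ _ _).symm
  have hsimple : ∀ I : Submodule ℝ V, (∀ x, ∀ y ∈ I, tl ν x y ∈ I) → I = ⊥ ∨ I = ⊤ := by
    intro I hI
    let K : LieIdeal ℝ L :=
      { toSubmodule := I.comap φ.toLinearMap
        lie_mem := by
          intro x m hm
          change φ ⁅x, m⁆ ∈ I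
          rw [hφ]
          exact hI _ _ hm }
    have hK : ∀ v, v ∈ I ↔ φ.symm v ∈ K := by
      intro v
      change v ∈ I ↔ φ (φ.symm v) ∈ I
      rw [LinearEquiv.apply_symm_apply]
    rcases LieAlgebra.IsSimple.eq_bot_or_eq_top (R := ℝ) K with h | h
    · left
      rw [Submodule.eq_bot_iff]
      intro v hv
      have := (hK v).1 hv
      rw [h] at this
      simpa using this
    · right
      rw [Submodule.eq_top_iff']
      intro v
      rw [hK, h]
      trivial
  have hne : ∃ x y, tl ν x y ≠ 0 := by
    obtain ⟨x, y, hxy⟩ := hna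
    refine ⟨φ x, φ y, ?_⟩
    rw [← hφ]
    simpa using hxy
  rcases dichotomy hL hstar hsimple hne with ⟨x, y, z, hx, h1, h2, h3⟩ | ⟨x, y, z, hx, h1, h2, h3, h4⟩
  · left
    refine ⟨φ.symm x, φ.symm y, φ.symm z, by simpa using hx, ?_, ?_, ?_⟩
    · rw [← hφs, h1]
    · rw [← hφs, h2]
    · rw [← hφs, h3]
  · right
    refine ⟨φ.symm x, φ.symm y, φ.symm z, by simpa using hx, ?_, ?_, ?_, ?_⟩
    · rw [← hφs, h1]
    · rw [← hφs, h2]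
    · rw [← hφs, h3, map_neg]
    · intro v
      obtain ⟨a, b, c, h⟩ := h4 (φ v)
      refine ⟨a, b, c, ?_⟩
      apply φ.injective
      rw [h]
      simp
end assembly

/-- Every finite-dimensional simple real Lie algebra not isomorphic to `sl(2, ℝ)` contains
a Lie subalgebra isomorphic to `su(2)`. -/
theorem simple_not_sl2_contains_su2
    (L : Type*) [LieRing L] [LieAlgebra ℝ L] [FiniteDimensional ℝ L]
    [LieAlgebra.IsSimple ℝ L]
    (h : IsEmpty (L ≃ₗ⁅ℝ⁆ LieAlgebra.SpecialLinear.sl (Fin 2) ℝ)) :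
    ContainsSU2 L := by
  rcases main_alt L with ⟨x, y, z, hx, h1, h2, h3⟩ | ⟨x, y, z, hx, h1, h2, h3, h4⟩
  · exact containsSU2_of hx h1 h2 h3
  · obtain ⟨f⟩ := sl2_of hx h1 h2 h3 h4
    exact (h.false f).elim
end

section
/- (Levi–Malcev) Let 𝔤 be a finite-dimensional real Lie algebra and let 𝔯 be its radical (the largest solvable ideal of 𝔤). Then there exists a semisimple Lie subalgebra 𝔥 of 𝔤 (a Levi factor) such that 𝔤 decomposes as the direct sum of vector subspaces 𝔤 = 𝔯 ⊕ 𝔥. -/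
namespace LeviAux

open LieAlgebra LieModule

section Weyl

variable {K : Type*} [Field K] [CharZero K]
variable {S : Type*} [LieRing S] [LieAlgebra K S] [FiniteDimensional K S] [HasTrivialRadical K S]

/-- A Lie algebra with trivial radical is perfect. -/
lemma perfect (P : Submodule K S) (hP : ∀ x y : S, ⁅x, y⁆ ∈ P) : P = ⊤ := by
  let I : LieIdeal K S := { P with lie_mem := fun {x m} _ => hP x m }
  have hc := LieIdeal.isCompl_killingCompl I
  have hbot : I.killingCompl = ⊥ := by
    rw [eq_bot_iff]
    intro x hx
    rw [LieIdeal.mem_killingCompl] at hx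
    have h1 : ∀ y : S, ⁅y, x⁆ = 0 := by
      intro y
      have h2 : ⁅y, x⁆ ∈ LinearMap.ker (killingForm K S) := by
        rw [LinearMap.mem_ker]
        ext z
        rw [LinearMap.zero_apply, LieModule.traceForm_comm, ← LieModule.traceForm_apply_lie_apply]
        exact hx _ (hP z y)
      rw [LieAlgebra.IsKilling.ker_killingForm_eq_bot] at h2
      simpa using h2
    have h3 : x ∈ LieAlgebra.center K S := by
      rw [LieModule.mem_maxTrivSubmodule]
      exact h1
    rw [LieAlgebra.center_eq_bot] at h3
    exact h3
  have hc : I = ⊤ := by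
    have h := hc.sup_eq_top
    rwa [hbot, sup_bot_eq] at h
  have : I.toSubmodule = ⊤ := by rw [hc]; rfl
  exact this

variable {M : Type*} [AddCommGroup M] [Module K M] [LieRingModule S M] [LieModule K S M]
  [FiniteDimensional K M]

lemma trivial_of_traceForm_eq_zero (h : traceForm K S M = 0) (x : S) (m : M) : ⁅x, m⁆ = 0 := by
  have hn := LieModule.isNilpotent_derivedSeries_of_traceForm_eq_zero h
  have htop : ∀ x : S, x ∈ derivedSeries K S 1 := by
    have := perfect (derivedSeries K S 1).toSubmodule (fun x y => by
      change ⁅x, y⁆ ∈ derivedSeries K S 1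
      exact LieSubmodule.lie_mem_lie (LieSubmodule.mem_top x) (LieSubmodule.mem_top y))
    intro x
    change x ∈ (derivedSeries K S 1).toSubmodule
    rw [this]; trivial
  rw [LieModule.isNilpotent_iff K] at hn
  obtain ⟨k, hk⟩ := hn
  have key : ∀ j ≤ k, ∀ m ∈ lowerCentralSeries K (derivedSeries K S 1) M (k - j),
      ∀ x : S, ⁅x, m⁆ = 0 := by
    intro j
    induction j with
    | zero =>
      intro _ m hm x
      rw [Nat.sub_zero, hk] at hm
      rw [(LieSubmodule.mem_bot m).1 hm, lie_zero]
    | succ j ih =>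
      intro hj m hm x
      have hmem : ∀ y : S, ⁅y, m⁆ ∈ lowerCentralSeries K (derivedSeries K S 1) M (k - j) := by
        intro y
        have : k - j = (k - (j + 1)) + 1 := by omega
        rw [this, lowerCentralSeries_succ]
        exact LieSubmodule.lie_mem_lie (LieSubmodule.mem_top (⟨y, htop y⟩ : derivedSeries K S 1)) hm
      let P : Submodule K S := LinearMap.ker ((toEnd K S M : S →ₗ[K] Module.End K M).flip m)
      have hP : P = ⊤ := perfect P (fun y z => by
        change ⁅⁅y, z⁆, m⁆ = 0
        rw [lie_lie, ih (by omega) _ (hmem z), ih (by omega) _ (hmem y), sub_zero])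
      have : x ∈ P := by rw [hP]; trivial
      exact this
  have := key k le_rfl m (by simp) x
  exact this

/-- The Casimir element. -/
lemma exists_casimir (h : traceForm K S M ≠ 0) :
    ∃ c : Module.End K M, (∀ (x : S) (m : M), c ⁅x, m⁆ = ⁅x, c m⁆) ∧
      (∀ N : Submodule K M, (∀ (x : S) (m : M), ⁅x, m⁆ ∈ N) → ∀ m, c m ∈ N) ∧
      LinearMap.trace K M c ≠ 0 := by
  classical
  let D : LieIdeal K S :=
    { LinearMap.ker (traceForm K S M) with
      lie_mem := fun {x m} hm => by
        change traceForm K S M ⁅x, m⁆ = 0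
        have hm' : traceForm K S M m = 0 := hm
        ext z
        rw [LieModule.traceForm_apply_lie_apply', hm']; simp }
  let J : LieIdeal K S := D.killingCompl
  have hDJ : IsCompl D J := LieIdeal.isCompl_killingCompl D
  have hB0 : ∀ x ∈ D, ∀ y, traceForm K S M x y = 0 := by
    intro x hx y
    have hx' : traceForm K S M x = 0 := hx
    rw [hx']; rfl
  let B : LinearMap.BilinForm K J := (traceForm K S M).restrict J.toSubmodule
  have hBdef : ∀ x y : J, B x y = traceForm K S M x y := fun x y => rfl
  have hsym : B.IsSymm := ⟨fun x y => by
    simp only [hBdef]; exact traceForm_comm K S M _ _⟩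
  have hdecomp : ∀ z : S, ∃ d ∈ D, ∃ j ∈ J, d + j = z := by
    intro z
    have : z ∈ D ⊔ J := by rw [hDJ.sup_eq_top]; trivial
    exact (LieSubmodule.mem_sup _ _ _).1 this
  have hB : B.Nondegenerate := by
    refine hsym.isRefl.nondegenerate_iff_separatingLeft.mpr ?_
    rintro ⟨x, hx⟩ hxy
    have hxD : x ∈ D := by
      change traceForm K S M x = 0
      ext z
      obtain ⟨d, hd, j, hj, rfl⟩ := hdecomp z
      rw [map_add, traceForm_comm, hB0 d hd, zero_add]
      exact hxy ⟨j, hj⟩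
    have : x ∈ D ⊓ J := ⟨hxD, hx⟩
    rw [hDJ.inf_eq_bot] at this
    exact Subtype.ext ((LieSubmodule.mem_bot x).1 this)
  have hJ : Nontrivial J := by
    by_contra hcon
    rw [not_nontrivial_iff_subsingleton] at hcon
    apply h
    ext z w
    obtain ⟨d, hd, j, hj, rfl⟩ := hdecomp z
    have : j = 0 := congrArg Subtype.val (Subsingleton.elim (⟨j, hj⟩ : J) 0)
    rw [this, add_zero, hB0 d hd]; rfl
  let b := Module.finBasis K J
  let b' := B.dualBasis hB b
  have e1 : ∀ y : J, ∑ j, B y (b' j) • b j = y := by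
    intro y
    have h1 := b.sum_repr y
    have h2 : ∀ j, B y (b' j) = b.repr y j := by
      intro j
      conv_lhs => rw [← h1]
      simp only [map_sum, map_smul, LinearMap.sum_apply, LinearMap.smul_apply]
      simp only [b', LinearMap.BilinForm.apply_dualBasis_right hB hsym, smul_eq_mul, mul_ite,
        mul_one, mul_zero]
      simp
    simp_rw [h2]; exact h1
  have e2 : ∀ y : J, ∑ j, B y (b j) • b' j = y := by
    intro y
    have h1 := b'.sum_repr y
    have h2 : ∀ j, B y (b j) = b'.repr y j := fun j =>
      (LinearMap.BilinForm.dualBasis_repr_apply hB b y j).symm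
    simp_rw [h2]; exact h1
  let c : Module.End K M := ∑ i, toEnd K S M (b i) ∘ₗ toEnd K S M (b' i)
  have hc : ∀ m, c m = ∑ i, ⁅((b i : J) : S), ⁅((b' i : J) : S), m⁆⁆ := by
    intro m
    simp [c]
  refine ⟨c, ?_, ?_, ?_⟩
  · intro x m
    have f1 : ∀ i (m : M), ⁅⁅x, ((b i : J) : S)⁆, m⁆ =
        ∑ j, traceForm K S M ⁅x, ((b i : J) : S)⁆ (b' j) • ⁅((b j : J) : S), m⁆ := by
      intro i m
      have := congrArg (((toEnd K S M : S →ₗ[K] Module.End K M).flip m) ∘ₗ J.toSubmodule.subtype)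
        (e1 ⁅x, b i⁆)
      rw [map_sum] at this
      simp only [map_smul] at this
      exact this.symm
    have f2 : ∀ i (m : M), ⁅⁅x, ((b' i : J) : S)⁆, m⁆ =
        ∑ j, traceForm K S M ⁅x, ((b' i : J) : S)⁆ (b j) • ⁅((b' j : J) : S), m⁆ := by
      intro i m
      have := congrArg (((toEnd K S M : S →ₗ[K] Module.End K M).flip m) ∘ₗ J.toSubmodule.subtype)
        (e2 ⁅x, b' i⁆)
      rw [map_sum] at this
      simp only [map_smul] at this
      exact this.symm
    rw [hc, hc, lie_sum]
    symm
    have step : ∀ i, ⁅x, ⁅((b i : J) : S), ⁅((b' i : J) : S), m⁆⁆⁆ =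
        ⁅((b i : J) : S), ⁅((b' i : J) : S), ⁅x, m⁆⁆⁆ +
        (⁅⁅x, ((b i : J) : S)⁆, ⁅((b' i : J) : S), m⁆⁆
          + ⁅((b i : J) : S), ⁅⁅x, ((b' i : J) : S)⁆, m⁆⁆) := by
      intro i
      rw [leibniz_lie x, leibniz_lie x ((b' i : J) : S) m, lie_add]
      abel
    simp_rw [step]
    rw [Finset.sum_add_distrib, Finset.sum_add_distrib, add_eq_left]
    simp_rw [f1, f2, lie_sum, lie_smul]
    rw [Finset.sum_comm (f := fun i j => traceForm K S M ⁅x, ((b' i : J) : S)⁆ (b j) •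
      ⁅((b i : J) : S), ⁅((b' j : J) : S), m⁆⁆), ← Finset.sum_add_distrib]
    refine Finset.sum_eq_zero fun i _ => ?_
    rw [← Finset.sum_add_distrib]
    refine Finset.sum_eq_zero fun j _ => ?_
    rw [← add_smul, traceForm_apply_lie_apply', traceForm_comm, neg_add_cancel, zero_smul]
  · intro N hN m
    rw [hc]
    exact N.sum_mem fun i _ => hN _ _
  · have : LinearMap.trace K M c = ∑ i, B (b i) (b' i) := by
      simp [c, hBdef, traceForm_apply_apply]
    rw [this]
    simp only [b', LinearMap.BilinForm.apply_dualBasis_right hB hsym]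
    simp only [if_true, Finset.sum_const, Finset.card_univ, Fintype.card_fin, nsmul_eq_mul, mul_one]
    exact_mod_cast (Module.finrank_pos (R := K) (M := J)).ne'

end Weyl

/-- A version of Weyl's theorem (complement to a submodule with trivial quotient). -/
lemma weyl {K : Type*} [Field K] [CharZero K]
    {S : Type*} [LieRing S] [LieAlgebra K S] [FiniteDimensional K S] [HasTrivialRadical K S]
    (n : ℕ) : ∀ (M : Type*) [AddCommGroup M] [Module K M] [LieRingModule S M] [LieModule K S M]
      [FiniteDimensional K M], Module.finrank K M ≤ n →
      ∀ N : Submodule K M, (∀ (x : S) (m : M), ⁅x, m⁆ ∈ N) →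
      ∀ m : M, ∃ m' ∈ N, ∀ x : S, ⁅x, m - m'⁆ = 0 := by
  induction n with
  | zero =>
    intro M _ _ _ _ _ hM N hN m
    have : Subsingleton M := Module.finrank_zero_iff.1 (Nat.le_zero.1 hM)
    exact ⟨0, N.zero_mem, fun x => Subsingleton.elim _ _⟩
  | succ n ih =>
    intro M _ _ _ _ _ hM N hN m
    by_cases ht : traceForm K S M = 0
    · exact ⟨0, N.zero_mem, fun x => trivial_of_traceForm_eq_zero ht _ _⟩
    obtain ⟨c, hcx, hcN, hctr⟩ := exists_casimir ht
    obtain ⟨k, hk⟩ := Filter.eventually_atTop.1 (LinearMap.eventually_isCompl_ker_pow_range_pow c)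
    have hcompl := hk (k + 1) (by omega)
    have hpow : ∀ (j : ℕ) (x : S) (m : M), (c ^ j) ⁅x, m⁆ = ⁅x, (c ^ j) m⁆ := by
      intro j x
      induction j with
      | zero => intro m; simp
      | succ j ihj => intro m; rw [pow_succ, Module.End.mul_apply, Module.End.mul_apply, hcx, ihj]
    let M₀ : LieSubmodule K S M :=
      { LinearMap.ker (c ^ (k + 1)) with
        lie_mem := fun {x m} hm => by
          change (c ^ (k + 1)) ⁅x, m⁆ = 0
          have hm' : (c ^ (k + 1)) m = 0 := hm
          rw [hpow, hm', lie_zero] }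
    have hlt : Module.finrank K M₀ < Module.finrank K M := by
      refine Submodule.finrank_lt (s := LinearMap.ker (c ^ (k + 1))) ?_
      intro htop
      have hz : c ^ (k + 1) = 0 := LinearMap.ker_eq_top.1 htop
      exact hctr (LinearMap.isNilpotent_trace_of_isNilpotent ⟨k + 1, hz⟩).eq_zero
    have hm : m ∈ LinearMap.ker (c ^ (k + 1)) ⊔ LinearMap.range (c ^ (k + 1)) := by
      rw [hcompl.sup_eq_top]; trivial
    obtain ⟨m₀, hm₀, m₁, hm₁, rfl⟩ := Submodule.mem_sup.1 hm
    obtain ⟨m₂, h₂, h₃⟩ := ih M₀ (by omega) (N.comap M₀.toSubmodule.subtype)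
      (fun x m => hN x (m : M)) ⟨m₀, hm₀⟩
    refine ⟨m₁ + m₂, N.add_mem ?_ h₂, fun x => ?_⟩
    · obtain ⟨w, rfl⟩ := hm₁
      rw [pow_succ', Module.End.mul_apply]
      exact hcN N hN _
    · have h4 := congrArg (Subtype.val) (h₃ x)
      have : m₀ + m₁ - (m₁ + (m₂ : M)) = m₀ - m₂ := by abel
      rw [this]
      exact h4

/-- Weyl's theorem for modules factoring through a quotient. -/
lemma weyl' {K : Type*} [Field K] [CharZero K]
    {S : Type*} [LieRing S] [LieAlgebra K S] [FiniteDimensional K S] [HasTrivialRadical K S]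
    {L : Type*} [LieRing L] [LieAlgebra K L] (f : L →ₗ⁅K⁆ S) (hf : Function.Surjective f)
    (M : Type*) [AddCommGroup M] [Module K M] [LieRingModule L M] [LieModule K L M]
    [FiniteDimensional K M] (hM : ∀ r : L, f r = 0 → ∀ m : M, ⁅r, m⁆ = 0)
    (N : Submodule K M) (hN : ∀ (x : L) (m : M), ⁅x, m⁆ ∈ N) (m : M) :
    ∃ m' ∈ N, ∀ x : L, ⁅x, m - m'⁆ = 0 := by
  obtain ⟨s, hs⟩ := (f : L →ₗ[K] S).exists_rightInverse_of_surjective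
    (LinearMap.range_eq_top.2 hf)
  have hs' : ∀ x, f (s x) = x := fun x => LinearMap.congr_fun hs x
  have hind : ∀ (x y : L), f x = f y → ∀ m : M, ⁅x, m⁆ = ⁅y, m⁆ := by
    intro x y hxy m
    rw [← sub_eq_zero, ← sub_lie]
    exact hM _ (by rw [map_sub, hxy, sub_self]) m
  let _ : LieRingModule S M :=
    { bracket := fun x m => ⁅s x, m⁆
      add_lie := fun x y m => by
        change ⁅s (x + y), m⁆ = ⁅s x, m⁆ + ⁅s y, m⁆
        rw [map_add, add_lie]
      lie_add := fun x m n => lie_add (s x) m n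
      leibniz_lie := fun x y m => by
        change ⁅s x, ⁅s y, m⁆⁆ = ⁅s ⁅x, y⁆, m⁆ + ⁅s y, ⁅s x, m⁆⁆
        rw [leibniz_lie, hind (s ⁅x, y⁆) ⁅s x, s y⁆ (by rw [LieHom.map_lie, hs', hs', hs']) m] }
  have _ : LieModule K S M :=
    { smul_lie := fun t x m => by
        change ⁅s (t • x), m⁆ = t • ⁅s x, m⁆
        rw [map_smul, smul_lie]
      lie_smul := fun t x m => lie_smul t (s x) m }
  have hact : ∀ (x : S) (m : M), ⁅x, m⁆ = ⁅s x, m⁆ := fun x m => rfl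
  obtain ⟨m', h1, h2⟩ := weyl (K := K) (S := S) _ M le_rfl N (fun x m => by rw [hact]; exact hN _ _) m
  refine ⟨m', h1, fun x => ?_⟩
  rw [← h2 (f x), hact]
  exact hind _ _ (hs' _).symm _

end LeviAux
namespace LeviAux

open LieAlgebra LieModule

lemma base {K : Type*} [Field K] [CharZero K]
    {S : Type*} [LieRing S] [LieAlgebra K S] [FiniteDimensional K S] [HasTrivialRadical K S]
    {L : Type*} [LieRing L] [LieAlgebra K L] [FiniteDimensional K L]
    (f : L →ₗ⁅K⁆ S) (hf : Function.Surjective f)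
    (hab : ∀ r r' : L, f r = 0 → f r' = 0 → ⁅r, r'⁆ = 0)
    (hz : (∀ r : L, f r = 0 → (∀ x : L, ⁅r, x⁆ = 0) → r = 0) ∨
      (∀ r : L, f r = 0 → ∀ x : L, ⁅x, r⁆ = 0)) :
    ∃ H : LieSubalgebra K L, (∀ x ∈ H, f x = 0 → x = 0) ∧ ∀ y, ∃ x ∈ H, f x = y := by
  have hfl : ∀ x r : L, f r = 0 → f ⁅x, r⁆ = 0 := fun x r hr => by
    rw [LieHom.map_lie, hr, lie_zero]
  let A : LieSubmodule K L (L →ₗ[K] L) :=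
    { carrier := {φ | (∀ x, f (φ x) = 0) ∧ ∃ t : K, ∀ r, f r = 0 → φ r = t • r}
      add_mem' := by
        rintro φ ψ ⟨h1, t, h2⟩ ⟨h3, u, h4⟩
        refine ⟨fun x => ?_, t + u, fun r hr => ?_⟩
        · rw [LinearMap.add_apply, map_add, h1, h3, add_zero]
        · rw [LinearMap.add_apply, h2 r hr, h4 r hr, add_smul]
      zero_mem' := ⟨fun x => by simp, 0, fun r hr => by simp⟩
      smul_mem' := by
        rintro a φ ⟨h1, t, h2⟩
        refine ⟨fun x => ?_, a * t, fun r hr => ?_⟩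
        · rw [LinearMap.smul_apply, map_smul, h1, smul_zero]
        · rw [LinearMap.smul_apply, h2 r hr, smul_smul]
      lie_mem := by
        rintro x φ ⟨h1, t, h2⟩
        refine ⟨fun y => ?_, 0, fun r hr => ?_⟩
        · rw [LieHom.lie_apply, map_sub, hfl _ _ (h1 y), h1, sub_zero]
        · rw [LieHom.lie_apply, h2 r hr, h2 _ (hfl x r hr), lie_smul, sub_self, zero_smul] }
  have hA : ∀ φ : A, (∀ x, f (φ.1 x) = 0) ∧ ∃ t : K, ∀ r, f r = 0 → φ.1 r = t • r := fun φ => φ.2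
  have hAlie : ∀ (x : L) (φ : A) (y : L), (⁅x, φ⁆ : A).1 y = ⁅x, φ.1 y⁆ - φ.1 ⁅x, y⁆ :=
    fun x φ y => LieHom.lie_apply _ _ _
  let C : LieSubmodule K L A :=
    { carrier := {φ | ∃ r, f r = 0 ∧ ∀ y, φ.1 y = ⁅r, y⁆}
      add_mem' := by
        rintro φ ψ ⟨r, h1, h2⟩ ⟨s, h3, h4⟩
        refine ⟨r + s, by rw [map_add, h1, h3, add_zero], fun y => ?_⟩
        change φ.1 y + ψ.1 y = _
        rw [h2, h4, add_lie]
      zero_mem' := ⟨0, by simp, fun y => by rw [zero_lie]; rfl⟩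
      smul_mem' := by
        rintro a φ ⟨r, h1, h2⟩
        refine ⟨a • r, by rw [map_smul, h1, smul_zero], fun y => ?_⟩
        change a • φ.1 y = _
        rw [h2, smul_lie]
      lie_mem := by
        rintro x φ ⟨r, h1, h2⟩
        refine ⟨⁅x, r⁆, hfl x r h1, fun y => ?_⟩
        rw [hAlie, h2, h2, lie_lie] }
  have hC : ∀ φ : A, φ ∈ C ↔ ∃ r, f r = 0 ∧ ∀ y, φ.1 y = ⁅r, y⁆ := fun φ => Iff.rfl
  let B : Submodule K A :=
    { carrier := {φ | ∀ r, f r = 0 → φ.1 r = 0}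
      add_mem' := by
        intro φ ψ h1 h2 r hr
        change φ.1 r + ψ.1 r = 0
        rw [h1 r hr, h2 r hr, add_zero]
      zero_mem' := fun r hr => rfl
      smul_mem' := by
        intro a φ h1 r hr
        change a • φ.1 r = 0
        rw [h1 r hr, smul_zero] }
  have hB : ∀ φ : A, φ ∈ B ↔ ∀ r, f r = 0 → φ.1 r = 0 := fun φ => Iff.rfl
  let q := LieSubmodule.Quotient.mk' C
  have hq : ∀ φ : A, q φ = 0 ↔ φ ∈ C := fun φ => LieSubmodule.Quotient.mk_eq_zero _
  have hqs : Function.Surjective q := LieSubmodule.Quotient.surjective_mk' C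
  have hM : ∀ r : L, f r = 0 → ∀ m : A ⧸ C, ⁅r, m⁆ = 0 := by
    intro r hr m
    obtain ⟨φ, rfl⟩ := hqs m
    rw [← LieModuleHom.map_lie, hq, hC]
    obtain ⟨h1, t, h2⟩ := hA φ
    refine ⟨-(t • r), by rw [map_neg, map_smul, hr, smul_zero, neg_zero], fun y => ?_⟩
    rw [hAlie, hab r _ hr (h1 y), h2 _ (by rw [LieHom.map_lie, hr, zero_lie]), neg_lie, smul_lie,
      zero_sub]
  have hN : ∀ (x : L) (m : A ⧸ C), ⁅x, m⁆ ∈ B.map (q : A →ₗ[K] A ⧸ C) := by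
    intro x m
    obtain ⟨φ, rfl⟩ := hqs m
    refine ⟨⁅x, φ⁆, ?_, LieModuleHom.map_lie q x φ⟩
    obtain ⟨h1, t, h2⟩ := hA φ
    intro r hr
    rw [hAlie, h2 r hr, h2 _ (hfl x r hr), lie_smul, sub_self]
  -- the projection onto the kernel
  obtain ⟨π, hπ⟩ := (LinearMap.ker (f : L →ₗ[K] S)).subtype.exists_leftInverse_of_injective
    (Submodule.ker_subtype _)
  let φ₀ : A := ⟨(LinearMap.ker (f : L →ₗ[K] S)).subtype ∘ₗ π, fun x => (π x).2, 1, fun r hr => by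
    have := LinearMap.congr_fun hπ ⟨r, hr⟩
    have := congrArg Subtype.val this
    rw [one_smul]
    exact this⟩
  have hφ₀ : ∀ r, f r = 0 → φ₀.1 r = r := fun r hr =>
    congrArg Subtype.val (LinearMap.congr_fun hπ ⟨r, hr⟩)
  obtain ⟨m', ⟨β, hβ, rfl⟩, hinv⟩ := weyl' f hf (A ⧸ C) hM _ hN (q φ₀)
  obtain ⟨φ, hφ⟩ : ∃ φ, φ = φ₀ - β := ⟨_, rfl⟩
  have hφr : ∀ r, f r = 0 → φ.1 r = r := by
    intro r hr
    rw [hφ]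
    change φ₀.1 r - β.1 r = r
    rw [hφ₀ r hr, (hB β).1 hβ r hr, sub_zero]
  have hφf : ∀ x, f (φ.1 x) = 0 := (hA φ).1
  have hφC : ∀ x : L, ∃ r, f r = 0 ∧ ∀ y, ⁅x, φ.1 y⁆ - φ.1 ⁅x, y⁆ = ⁅r, y⁆ := by
    intro x
    have h1 : ⁅x, φ⁆ ∈ C := by
      rw [← hq, LieModuleHom.map_lie, hφ, map_sub]
      exact hinv x
    obtain ⟨r, hr, h⟩ := (hC _).1 h1
    exact ⟨r, hr, fun y => by rw [← hAlie]; exact h y⟩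
  rcases hz with hz | hz
  · let H : LieSubalgebra K L :=
      { carrier := {x | ∀ y, ⁅x, φ.1 y⁆ = φ.1 ⁅x, y⁆}
        add_mem' := by
          intro a b ha hb y
          rw [add_lie, add_lie, map_add, ha, hb]
        zero_mem' := fun y => by simp
        smul_mem' := by
          intro t a ha y
          rw [smul_lie, smul_lie, map_smul, ha]
        lie_mem' := by
          intro a b ha hb y
          rw [lie_lie, lie_lie, map_sub, hb, ha, ha, hb] }
    refine ⟨H, fun x hx hx0 => hz x hx0 fun y => ?_, fun y => ?_⟩
    · have h1 : ⁅x, φ.1 y⁆ = φ.1 ⁅x, y⁆ := hx y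
      rw [hab x _ hx0 (hφf y), hφr _ (by rw [LieHom.map_lie, hx0, zero_lie])] at h1
      exact h1.symm
    · obtain ⟨x, rfl⟩ := hf y
      obtain ⟨r, hr, h⟩ := hφC x
      refine ⟨x + r, fun y => ?_, by rw [map_add, hr, add_zero]⟩
      rw [add_lie, add_lie, map_add, hab r _ hr (hφf y),
        hφr ⁅r, y⁆ (by rw [LieHom.map_lie, hr, zero_lie]), ← h y]
      abel
  · have hz' : ∀ r, f r = 0 → ∀ y : L, ⁅r, y⁆ = 0 := fun r hr y => by
      rw [← lie_skew, hz r hr, neg_zero]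
    have hφ0 : ∀ x y : L, φ.1 ⁅x, y⁆ = 0 := by
      intro x y
      obtain ⟨r, hr, h⟩ := hφC x
      have := h y
      rw [hz _ (hφf y), hz' r hr, zero_sub, neg_eq_zero] at this
      exact this
    let H : LieSubalgebra K L :=
      { LinearMap.ker φ.1 with
        lie_mem' := fun {a b} _ _ => hφ0 a b }
    refine ⟨H, fun x hx hx0 => ?_, fun y => ?_⟩
    · have : φ.1 x = 0 := hx
      rwa [hφr x hx0] at this
    · obtain ⟨x, rfl⟩ := hf y
      refine ⟨x - φ.1 x, ?_, by rw [map_sub, hφf, sub_zero]⟩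
      change φ.1 (x - φ.1 x) = 0
      rw [map_sub, hφr _ (hφf x), sub_self]

lemma step {K : Type*} [Field K]
    {S : Type*} [LieRing S] [LieAlgebra K S]
    {L : Type*} [LieRing L] [LieAlgebra K L] [FiniteDimensional K L]
    (f : L →ₗ⁅K⁆ S) (I : LieIdeal K L) {H' : LieSubalgebra K (L ⧸ I)}
    (h1 : ∀ x : L, LieSubmodule.Quotient.mk (N := I) x ∈ H' → f x = 0 → x ∈ I)
    (h2 : ∀ y, ∃ x : L, LieSubmodule.Quotient.mk (N := I) x ∈ H' ∧ f x = y)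
    (hrec : ∀ T : LieSubalgebra K L, (∀ x ∈ T, f x = 0 → x ∈ I) → (∀ y, ∃ x ∈ T, f x = y) →
      ∃ H : LieSubalgebra K T, (∀ x ∈ H, f x = 0 → x = 0) ∧ ∀ y, ∃ x ∈ H, f (x : L) = y) :
    ∃ H : LieSubalgebra K L, (∀ x ∈ H, f x = 0 → x = 0) ∧ ∀ y, ∃ x ∈ H, f x = y := by
  let T : LieSubalgebra K L :=
    { carrier := {x | LieSubmodule.Quotient.mk (N := I) x ∈ H'}
      add_mem' := fun {a b} ha hb => H'.add_mem ha hb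
      zero_mem' := H'.zero_mem
      smul_mem' := fun t a ha => H'.smul_mem t ha
      lie_mem' := fun {a b} ha hb => by
        change LieSubmodule.Quotient.mk (N := I) ⁅a, b⁆ ∈ H'
        rw [LieSubmodule.Quotient.mk_bracket]
        exact H'.lie_mem ha hb }
  obtain ⟨H, h3, h4⟩ := hrec T h1 h2
  refine ⟨H.map T.incl, ?_, ?_⟩
  · rintro _ ⟨x, hx, rfl⟩ h0
    exact congrArg Subtype.val (h3 x hx h0)
  · intro y
    obtain ⟨x, hx, rfl⟩ := h4 y
    exact ⟨x, ⟨x, hx, rfl⟩, rfl⟩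

lemma main {K : Type*} [Field K] [CharZero K]
    {S : Type*} [LieRing S] [LieAlgebra K S] [FiniteDimensional K S] [HasTrivialRadical K S]
    (n : ℕ) : ∀ (L : Type*) [LieRing L] [LieAlgebra K L] [FiniteDimensional K L]
    (f : L →ₗ⁅K⁆ S) (_ : Function.Surjective f) (_ : IsSolvable f.ker)
    (_ : Module.finrank K L ≤ n),
    ∃ H : LieSubalgebra K L, (∀ x ∈ H, f x = 0 → x = 0) ∧ ∀ y, ∃ x ∈ H, f x = y := by
  induction n with
  | zero =>
    intro L _ _ _ f hf hsol hn
    have : Subsingleton L := Module.finrank_zero_iff.1 (Nat.le_zero.1 hn)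
    refine ⟨⊤, fun x _ _ => Subsingleton.elim _ _, fun y => ?_⟩
    obtain ⟨x, rfl⟩ := hf y
    exact ⟨x, trivial, rfl⟩
  | succ n ih =>
    intro L _ _ _ f hf hsol hn
    have red : ∀ I : LieIdeal K L, I ≤ f.ker → I ≠ ⊥ → I ≠ f.ker →
        ∃ H : LieSubalgebra K L, (∀ x ∈ H, f x = 0 → x = 0) ∧ ∀ y, ∃ x ∈ H, f x = y := by
      intro I hIle hIbot hIne
      have hI : ∀ x ∈ I, f x = 0 := fun x hx => LieHom.mem_ker.1 (hIle hx)
      let f' : (L ⧸ I) →ₗ⁅K⁆ S :=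
        { (I.toSubmodule.liftQ (f : L →ₗ[K] S) (fun x hx => hI x hx)) with
          map_lie' := by
            intro x y
            obtain ⟨x, rfl⟩ := LieSubmodule.Quotient.surjective_mk' I x
            obtain ⟨y, rfl⟩ := LieSubmodule.Quotient.surjective_mk' I y
            exact LieHom.map_lie f x y }
      have hf' : ∀ x : L, f' (LieSubmodule.Quotient.mk (N := I) x) = f x := fun x => rfl
      have hmk0 : ∀ x : L, LieSubmodule.Quotient.mk (N := I) x = 0 ↔ x ∈ I :=
        fun x => LieSubmodule.Quotient.mk_eq_zero _
      have hfin : Module.finrank K (L ⧸ I) ≤ n := by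
        have h1 := I.toSubmodule.finrank_quotient_add_finrank
        have h2 : 0 < Module.finrank K I.toSubmodule := by
          rw [Module.finrank_pos_iff, Submodule.nontrivial_iff_ne_bot]
          simpa using hIbot
        have h3 : Module.finrank K (L ⧸ I) = Module.finrank K (L ⧸ I.toSubmodule) := rfl
        omega
      have hsol' : IsSolvable f'.ker := by
        let g : f.ker →ₗ⁅K⁆ f'.ker :=
          { toFun := fun x => ⟨LieSubmodule.Quotient.mk (N := I) x.1,
              LieHom.mem_ker.2 (LieHom.mem_ker.1 x.2)⟩
            map_add' := fun x y => rfl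
            map_smul' := fun t x => rfl
            map_lie' := fun {x y} => rfl }
        have hg : Function.Surjective g := by
          rintro ⟨x, hx⟩
          obtain ⟨x, rfl⟩ := LieSubmodule.Quotient.surjective_mk' I x
          exact ⟨⟨x, LieHom.mem_ker.2 (LieHom.mem_ker.1 hx)⟩, rfl⟩
        exact hg.lieAlgebra_isSolvable
      obtain ⟨H', h1, h2⟩ := ih (L ⧸ I) f' (fun y => by
        obtain ⟨x, rfl⟩ := hf y
        exact ⟨LieSubmodule.Quotient.mk (N := I) x, rfl⟩) hsol' hfin
      refine step f I (H' := H') (fun x hx hx0 => (hmk0 x).1 (h1 _ hx hx0)) (fun y => ?_) ?_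
      · obtain ⟨x, hx, hxy⟩ := h2 y
        obtain ⟨x, rfl⟩ := LieSubmodule.Quotient.surjective_mk' I x
        exact ⟨x, hx, hxy⟩
      · intro T hT1 hT2
        have hTsol : IsSolvable (f.comp T.incl).ker := by
          let g : (f.comp T.incl).ker →ₗ⁅K⁆ f.ker :=
            { toFun := fun x => ⟨x.1.1, LieHom.mem_ker.2 (LieHom.mem_ker.1 x.2)⟩
              map_add' := fun x y => rfl
              map_smul' := fun t x => rfl
              map_lie' := fun {x y} => rfl }
          have hg : Function.Injective g := by
            intro x y hxy
            exact Subtype.ext (Subtype.ext (congrArg (fun z : f.ker => (z : L)) hxy))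
          exact hg.lieAlgebra_isSolvable
        have hTfin : Module.finrank K T ≤ n := by
          have : Module.finrank K T < Module.finrank K L := by
            refine Submodule.finrank_lt (s := T.toSubmodule) ?_
            intro htop
            apply hIne
            refine le_antisymm hIle fun x hx => hT1 x ?_ (LieHom.mem_ker.1 hx)
            change x ∈ T.toSubmodule
            rw [htop]; trivial
          omega
        exact ih T (f.comp T.incl) (fun y => by
          obtain ⟨x, hx, hxy⟩ := hT2 y
          exact ⟨⟨x, hx⟩, hxy⟩) hTsol hTfin
    by_cases hker : f.ker = ⊥
    · refine ⟨⊤, fun x _ hx => ?_, fun y => ?_⟩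
      · have : x ∈ f.ker := LieHom.mem_ker.2 hx
        rw [hker] at this
        exact (LieSubmodule.mem_bot x).1 this
      · obtain ⟨x, rfl⟩ := hf y
        exact ⟨x, trivial, rfl⟩
    by_cases hab : ⁅f.ker, f.ker⁆ = ⊥
    · by_cases hc1 : f.ker ⊓ LieAlgebra.center K L = ⊥
      · refine base f hf (fun r r' hr hr' => ?_) (Or.inl fun r hr h => ?_)
        · have := LieSubmodule.lie_mem_lie (LieHom.mem_ker.2 hr) (LieHom.mem_ker.2 hr')
          rw [hab] at this
          exact (LieSubmodule.mem_bot _).1 this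
        · have : r ∈ f.ker ⊓ LieAlgebra.center K L := by
            refine ⟨LieHom.mem_ker.2 hr, ?_⟩
            change r ∈ LieAlgebra.center K L
            rw [LieModule.mem_maxTrivSubmodule]
            intro x
            rw [← lie_skew, h, neg_zero]
          rw [hc1] at this
          exact (LieSubmodule.mem_bot _).1 this
      · by_cases hc2 : f.ker ⊓ LieAlgebra.center K L = f.ker
        · refine base f hf (fun r r' hr hr' => ?_) (Or.inr fun r hr x => ?_)
          · have := LieSubmodule.lie_mem_lie (LieHom.mem_ker.2 hr) (LieHom.mem_ker.2 hr')
            rw [hab] at this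
            exact (LieSubmodule.mem_bot _).1 this
          · have h1 : r ∈ LieAlgebra.center K L := inf_eq_left.1 hc2 (LieHom.mem_ker.2 hr)
            rw [LieModule.mem_maxTrivSubmodule] at h1
            exact h1 x
        · exact red _ inf_le_left hc1 hc2
    · refine red _ (LieSubmodule.lie_le_left _ _) hab ?_
      intro heq
      obtain ⟨k, hk⟩ := (isSolvable_iff K f.ker).1 hsol
      rw [LieIdeal.derivedSeries_eq_bot_iff] at hk
      have : ∀ j, derivedSeriesOfIdeal K L j f.ker = f.ker := by
        intro j
        induction j with
        | zero => rfl
        | succ j ihj => rw [derivedSeriesOfIdeal_succ, ihj, heq]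
      exact hker ((this k).symm.trans hk)

/-- The quotient by the radical has trivial radical. -/
lemma quot_radical {K : Type*} [Field K]
    {L : Type*} [LieRing L] [LieAlgebra K L] [FiniteDimensional K L] :
    HasTrivialRadical K (L ⧸ radical K L) := by
  rw [hasTrivialRadical_iff_no_abelian_ideals]
  intro I hI
  have hmk0 : ∀ x : L, LieSubmodule.Quotient.mk (N := radical K L) x = 0 ↔ x ∈ radical K L :=
    fun x => LieSubmodule.Quotient.mk_eq_zero _
  let J : LieIdeal K L :=
    { carrier := {x | LieSubmodule.Quotient.mk (N := radical K L) x ∈ I}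
      add_mem' := fun {a b} ha hb => I.add_mem ha hb
      zero_mem' := I.zero_mem
      smul_mem' := fun t a ha => I.smul_mem t ha
      lie_mem := fun {a b} hb => by
        change LieSubmodule.Quotient.mk (N := radical K L) ⁅a, b⁆ ∈ I
        rw [LieSubmodule.Quotient.mk_bracket]
        exact I.lie_mem hb }
  have hJJ : ⁅J, J⁆ ≤ radical K L := by
    rw [LieSubmodule.lie_le_iff]
    intro x hx y hy
    rw [← hmk0, LieSubmodule.Quotient.mk_bracket]
    exact congrArg Subtype.val
      (hI.trivial (⟨_, hx⟩ : I) (⟨_, hy⟩ : I))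
  have hJ : IsSolvable J := by
    obtain ⟨k, hk⟩ := (isSolvable_iff K (radical K L)).1 inferInstance
    rw [LieIdeal.derivedSeries_eq_bot_iff] at hk
    refine (isSolvable_iff K J).2 ⟨k + 1, ?_⟩
    rw [LieIdeal.derivedSeries_eq_bot_iff, derivedSeriesOfIdeal_add, eq_bot_iff, ← hk]
    exact derivedSeriesOfIdeal_mono hJJ k
  have hle : J ≤ radical K L := (LieIdeal.solvable_iff_le_radical K L J).1 hJ
  rw [eq_bot_iff]
  intro x hx
  obtain ⟨x, rfl⟩ := LieSubmodule.Quotient.surjective_mk' _ x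
  exact (LieSubmodule.mem_bot _).2 ((hmk0 x).2 (hle hx))

end LeviAux

/-- **Levi–Malcev**: every finite-dimensional real Lie algebra decomposes as the direct
sum (of vector subspaces) of its radical and a semisimple subalgebra (a Levi factor). -/
theorem levi_malcev
    (L : Type*) [LieRing L] [LieAlgebra ℝ L] [FiniteDimensional ℝ L] :
    ∃ H : LieSubalgebra ℝ L, LieAlgebra.HasTrivialRadical ℝ H ∧
      IsCompl (LieAlgebra.radical ℝ L).toSubmodule H.toSubmodule := by
  have hrad : LieAlgebra.HasTrivialRadical ℝ (L ⧸ LieAlgebra.radical ℝ L) := LeviAux.quot_radical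
  have hfd : FiniteDimensional ℝ (L ⧸ LieAlgebra.radical ℝ L) :=
    inferInstanceAs (FiniteDimensional ℝ (L ⧸ (LieAlgebra.radical ℝ L).toSubmodule))
  let f : L →ₗ⁅ℝ⁆ (L ⧸ LieAlgebra.radical ℝ L) :=
    { (LieSubmodule.Quotient.mk' (LieAlgebra.radical ℝ L) : L →ₗ[ℝ] L ⧸ LieAlgebra.radical ℝ L) with
      map_lie' := fun {x y} => LieSubmodule.Quotient.mk_bracket _ x y }
  have hf : Function.Surjective f := LieSubmodule.Quotient.surjective_mk' _
  have hf0 : ∀ x, f x = 0 ↔ x ∈ LieAlgebra.radical ℝ L :=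
    fun x => LieSubmodule.Quotient.mk_eq_zero _
  have hker : f.ker = LieAlgebra.radical ℝ L := by
    ext x
    rw [LieHom.mem_ker, hf0]
  obtain ⟨H, h1, h2⟩ := LeviAux.main _ L f hf (by rw [hker]; infer_instance) le_rfl
  refine ⟨H, ?_, ?_⟩
  · let g : H →ₗ⁅ℝ⁆ (L ⧸ LieAlgebra.radical ℝ L) := f.comp H.incl
    have hg : Function.Bijective g := by
      constructor
      · intro x y hxy
        have h3 : f ((x : L) - y) = 0 := by
          rw [map_sub, sub_eq_zero]; exact hxy
        exact Subtype.ext (sub_eq_zero.1 (h1 _ (H.sub_mem x.2 y.2) h3))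
      · intro y
        obtain ⟨x, hx, rfl⟩ := h2 y
        exact ⟨⟨x, hx⟩, rfl⟩
    have hk : LieAlgebra.IsKilling ℝ H :=
      LieAlgebra.isKilling_of_equiv (LieEquiv.ofBijective g hg).symm
    infer_instance
  · constructor
    · rw [Submodule.disjoint_def]
      intro x hx hxH
      exact h1 x hxH ((hf0 x).2 hx)
    · rw [codisjoint_iff, eq_top_iff]
      intro x _
      obtain ⟨y, hy, hxy⟩ := h2 (f x)
      rw [Submodule.mem_sup]
      refine ⟨x - y, ?_, y, hy, by abel⟩
      exact (hf0 _).1 (by rw [map_sub, hxy, sub_self])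
end
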